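/- arXiv:1507.00380 — 2 statements merged into one kernel-verified Lean document; each statement's English description precedes it below -/
import Mathlib

section
/- Let S = k[y_1,…,y_s] and R = k[x_0,…,x_n] be polynomial rings over a field k, and let f_1,…,f_s ∈ R be an R-regular sequence of homogeneous elements all of the same degree d > 0. Let I = (g_1,…,g_r) be a homogeneous ideal in S, set p_i = g_i(f_1,…,f_s) ∈ R and J = (p_1,…,p_r). Then for every i ≥ 0, dim_k Tor_i^S(S/I, k) = dim_k Tor_i^R(R/J, k); in particular S/I is Cohen–Macaulay if and only if R/J is Cohen–Macaulay. Moreover, if I is a monomial ideal, the same conclusions hold without the assumption that the f_i all have the same degree. -/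
/- ------------------------------------------------------------------
   Common definitions
------------------------------------------------------------------ -/

open MvPolynomial CategoryTheory

noncomputable section

/-- The height of an ideal: the infimum of the heights of the prime ideals containing it. -/
noncomputable def idealHeight {A : Type*} [CommRing A] (I : Ideal A) : ℕ∞ :=
  ⨅ P ∈ {P : PrimeSpectrum A | I ≤ P.asIdeal}, Order.height P

/-- The depth of a module `M` with respect to an ideal `J`: the supremum of the lengths of
`M`-regular sequences consisting of elements of `J`. -/
noncomputable def idealDepth {A : Type*} [CommRing A] (J : Ideal A)
    (M : Type*) [AddCommGroup M] [Module A M] : ℕ∞ :=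
  sSup {n : ℕ∞ | ∃ rs : List A, (rs.length : ℕ∞) = n ∧ (∀ r ∈ rs, r ∈ J) ∧
    RingTheory.Sequence.IsRegular M rs}

/-- The irrelevant maximal ideal `(x_i : i ∈ σ)` of the polynomial ring `k[x_i : i ∈ σ]`. -/
def irrelevantIdeal (k : Type) [Field k] (σ : Type) : Ideal (MvPolynomial σ k) :=
  Ideal.span (Set.range (X : σ → MvPolynomial σ k))

/-- The quotient of a polynomial ring by an ideal `I` is Cohen–Macaulay if its depth with
respect to the irrelevant maximal ideal equals its Krull dimension. -/
def IsCMQuotient {k : Type} [Field k] {σ : Type} (I : Ideal (MvPolynomial σ k)) : Prop :=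
  (idealDepth (irrelevantIdeal k σ) (MvPolynomial σ k ⧸ I) : WithBot ℕ∞)
    = ringKrullDim (MvPolynomial σ k ⧸ I)

/-- An ideal of a polynomial ring is homogeneous if it contains all homogeneous components
of each of its elements. -/
def IsHomogeneousIdeal {k : Type} [Field k] {σ : Type} (I : Ideal (MvPolynomial σ k)) : Prop :=
  ∀ p ∈ I, ∀ i : ℕ, homogeneousComponent i p ∈ I

/-- The Hilbert function of `R/I`, `t ↦ dim_k [R/I]_t`, as a function `ℤ → ℤ`
(equal to `0` in negative degrees). -/
noncomputable def hilbertFn (k : Type) [Field k] {σ : Type} (I : Ideal (MvPolynomial σ k))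
    (t : ℤ) : ℤ :=
  if t < 0 then 0
  else
    (Module.finrank k (homogeneousSubmodule σ k t.toNat) : ℤ) -
    (Module.finrank k
      ((Submodule.restrictScalars k (I : Submodule (MvPolynomial σ k) (MvPolynomial σ k))) ⊓
        homogeneousSubmodule σ k t.toNat : Submodule k (MvPolynomial σ k)) : ℤ)

/-- `P` is the Hilbert polynomial of `R/I` if it agrees with the Hilbert function of `R/I`
in all sufficiently large degrees. -/
def IsHilbertPolyOf (k : Type) [Field k] {σ : Type} (I : Ideal (MvPolynomial σ k))
    (P : Polynomial ℚ) : Prop :=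
  ∃ N : ℤ, ∀ t : ℤ, N ≤ t → (hilbertFn k I t : ℚ) = P.eval (t : ℚ)

open Classical in
/-- The Hilbert polynomial of `R/I` (defined as `0` if none exists). -/
noncomputable def hilbertPoly (k : Type) [Field k] {σ : Type} (I : Ideal (MvPolynomial σ k)) :
    Polynomial ℚ :=
  if h : ∃ P : Polynomial ℚ, IsHilbertPolyOf k I P then h.choose else 0

/-- The multiplicity (degree) `e(R/I)`: `(δ-1)!` times the leading coefficient of the Hilbert
polynomial of `R/I`, whose degree is `δ - 1` where `δ = dim R/I ≥ 1`. -/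
noncomputable def multiplicityDeg (k : Type) [Field k] {σ : Type}
    (I : Ideal (MvPolynomial σ k)) : ℚ :=
  (Nat.factorial (hilbertPoly k I).natDegree) * (hilbertPoly k I).leadingCoeff

/-- The `m`-th symbolic power of an ideal `J`:
`J^{(m)} = ⋂_{P ∈ Ass(A/J)} (J^m A_P ∩ A)`. -/
noncomputable def symbolicPower {A : Type*} [CommRing A] (J : Ideal A) (m : ℕ) : Ideal A :=
  sInf { K : Ideal A | ∃ (P : Ideal A) (hP : IsAssociatedPrime P (A ⧸ J)),
    K = Ideal.comap (algebraMap A (Localization (@Ideal.primeCompl A _ P hP.1)))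
          (Ideal.map (algebraMap A (Localization (@Ideal.primeCompl A _ P hP.1))) (J ^ m)) }

/-- `α(I)`: the least degree of a nonzero form in `I`. -/
noncomputable def alphaDeg (k : Type) [Field k] {σ : Type} (I : Ideal (MvPolynomial σ k)) : ℕ :=
  sInf {d : ℕ | ∃ p ∈ I, p ≠ 0 ∧ MvPolynomial.IsHomogeneous p d}

/-- `dim_k Tor_i^A(M, N)`, the rank over the base field `k` of the Tor module. -/
noncomputable def torRank (k : Type) [Field k] (A : Type) [CommRing A] [Algebra k A]
    (M N : Type) [AddCommGroup M] [Module A M] [AddCommGroup N] [Module A N] (i : ℕ) :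
    Cardinal :=
  Module.rank k (RestrictScalars k A
    (((Tor (ModuleCat A) i).obj (ModuleCat.of A M)).obj (ModuleCat.of A N)))

/-- The `i`-th total Betti number `dim_k Tor_i(S/I, k)` of `S/I`, where
`k = S/(x_i : i ∈ σ)`. -/
noncomputable def bettiNum (k : Type) [Field k] {σ : Type} (I : Ideal (MvPolynomial σ k))
    (i : ℕ) : Cardinal :=
  torRank k (MvPolynomial σ k) (MvPolynomial σ k ⧸ I)
    (MvPolynomial σ k ⧸ irrelevantIdeal k σ) i

/-- The first map `I_S → I_C ⊕ I_S`, `g ↦ (g, f·g)`, of the basic double linkage sequence. -/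
def bdlFirstMap {A : Type*} [CommRing A] {I_S I_C : Ideal A} (h : I_S ≤ I_C) (f : A) :
    I_S →ₗ[A] I_C × I_S :=
  LinearMap.prod (Submodule.inclusion h) (f • LinearMap.id)

/-- The second map `I_C ⊕ I_S → f·I_C + I_S`, `(a, b) ↦ f·a - b`, of the basic double
linkage sequence. -/
def bdlSecondMap {A : Type*} [CommRing A] (I_C I_S : Ideal A) (f : A) :
    I_C × I_S →ₗ[A] ↥(Ideal.span {f} * I_C + I_S) :=
  LinearMap.coprod
    (LinearMap.codRestrict ((Ideal.span {f} * I_C + I_S : Ideal A) : Submodule A A)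
      (f • (Submodule.subtype (I_C : Submodule A A)))
      (fun c => Submodule.mem_sup_left
        (Ideal.mul_mem_mul (Ideal.mem_span_singleton_self f) c.2)))
    (- LinearMap.codRestrict ((Ideal.span {f} * I_C + I_S : Ideal A) : Submodule A A)
      (Submodule.subtype (I_S : Submodule A A))
      (fun c => Submodule.mem_sup_right c.2))

/-- The ideal `I_{V_{λ,c}}` of the codimension-`c` configuration determined by `f_1, …, f_s`:
the intersection of the ideals `(f_{i_1}, …, f_{i_c})` over all `c`-subsets. -/
def configIdeal {A : Type*} [CommRing A] {s : ℕ} (c : ℕ) (f : Fin s → A) : Ideal A :=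
  ⨅ T ∈ {T : Finset (Fin s) | T.card = c}, Ideal.span (f '' ↑T)

/-- Every sublist of at most `m` of the elements `f 1, …, f s` (in any order, without
repetitions) is a regular sequence. -/
def SubsetsRegular {A : Type*} [CommRing A] {s : ℕ} (f : Fin s → A) (m : ℕ) : Prop :=
  ∀ l : List (Fin s), l.Nodup → l.length ≤ m →
    RingTheory.Sequence.IsRegular A (l.map f)

/-- `Δ` is (the independence complex of) a matroid on `{1, …, s}`: a nonempty collection of
subsets closed under inclusion and satisfying the augmentation axiom. -/
def IsMatroid {s : ℕ} (Δ : Finset (Fin s) → Prop) : Prop :=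
  Δ ∅ ∧ (∀ F G : Finset (Fin s), Δ F → G ⊆ F → Δ G) ∧
    (∀ F G : Finset (Fin s), Δ F → Δ G → G.card < F.card →
      ∃ j ∈ F, j ∉ G ∧ Δ (insert j G))

/-- `F` is a basis (facet) of the simplicial complex `Δ`: a maximal face. -/
def IsBasisOf {s : ℕ} (Δ : Finset (Fin s) → Prop) (F : Finset (Fin s)) : Prop :=
  Δ F ∧ ∀ G : Finset (Fin s), Δ G → F ⊆ G → G = F

/-- The Stanley–Reisner ideal of `Δ`, generated by the squarefree monomials corresponding
to the non-faces of `Δ`. -/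
def stanleyReisnerIdeal (k : Type) [Field k] {s : ℕ} (Δ : Finset (Fin s) → Prop) :
    Ideal (MvPolynomial (Fin s) k) :=
  Ideal.span
    ((fun F : Finset (Fin s) => ∏ i ∈ F, (X i : MvPolynomial (Fin s) k)) '' {F | ¬ Δ F})

/-- The ideal `I_{W_c}`: the intersection of all ideals `(A_{i_1,j_1}, …, A_{i_c,j_c})`
where `i_1 < ⋯ < i_c` and each generator is chosen from a different group. -/
def multiPartiteIdeal {A : Type*} [CommRing A] {s : ℕ} (c : ℕ) {e : Fin s → ℕ}
    (g : (i : Fin s) → Fin (e i) → A) : Ideal A :=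
  ⨅ T ∈ {T : Finset (Fin s) | T.card = c}, ⨅ j : (i : Fin s) → Fin (e i),
    Ideal.span ((fun i => g i (j i)) '' ↑T)

end

open Pointwise in
theorem eval₂_sum_smul_eq_zero {A B M ι : Type*} [CommRing A] [CommRing B] [AddCommGroup M]
    [Module A M] (ψ : B →+* A) (r : A) (hr : IsSMulRegular M r) (b : ι → M)
    (hb : ∀ q : ι →₀ B, (q.sum fun i a => ψ a • b i) ∈ r • (⊤ : Submodule A M) → q = 0)
    (Q : ι →₀ Polynomial B) (hQ : (Q.sum fun i a => a.eval₂ ψ r • b i) = 0) : Q = 0 := by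
  classical
  obtain ⟨N, hN⟩ : ∃ N : ℕ, ∀ i, (Q i).degree < N := by
    refine ⟨Q.support.sup (fun i => (Q i).natDegree) + 1, fun i => ?_⟩
    by_cases hi : i ∈ Q.support
    · refine Polynomial.degree_le_natDegree.trans_lt ?_
      have := Finset.le_sup (f := fun i => (Q i).natDegree) hi
      exact_mod_cast Nat.lt_succ_of_le this
    · rw [Finsupp.notMem_support_iff.mp hi, Polynomial.degree_zero]
      exact WithBot.bot_lt_coe _
  induction N generalizing Q with
  | zero =>
    ext1 i
    simpa [Polynomial.degree_eq_bot] using hN i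
  | succ N ih =>
    let D : ι →₀ Polynomial B := Q.mapRange Polynomial.divX (by simp)
    let q : ι →₀ B := Q.mapRange (fun P => P.coeff 0) (by simp)
    have hsum : (q.sum fun i a => ψ a • b i) + r • (D.sum fun i a => a.eval₂ ψ r • b i) = 0 := by
      have hqsum : (q.sum fun i a => ψ a • b i) = Q.sum fun i P => ψ (P.coeff 0) • b i :=
        Finsupp.sum_mapRange_index (by simp)
      rw [← hQ, hqsum, Finsupp.sum_mapRange_index (by simp), Finsupp.smul_sum, ← Finsupp.sum_add]
      refine Finsupp.sum_congr fun i _ => ?_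
      conv_rhs => rw [← Polynomial.divX_mul_X_add (Q i)]
      rw [Polynomial.eval₂_add, Polynomial.eval₂_mul, Polynomial.eval₂_C, Polynomial.eval₂_X,
        add_smul, smul_smul, mul_comm, add_comm]
    have hq : q = 0 := by
      apply hb
      rw [eq_neg_of_add_eq_zero_left hsum]
      exact neg_mem (Submodule.smul_mem_pointwise_smul _ _ _ trivial)
    have hD : D = 0 := by
      apply ih
      · rw [hq, Finsupp.sum_zero_index, zero_add] at hsum
        exact hr (by simpa using hsum)
      · intro i
        by_cases h0 : Q i = 0
        · simp [D, h0]
        · have h1 : (D i).degree < (Q i).degree := by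
            simpa [D] using Polynomial.degree_divX_lt h0
          have h2 := hN i
          rw [Polynomial.degree_eq_natDegree h0] at h1 h2
          have h3 : (Q i).natDegree ≤ N := by
            have : (Q i).natDegree < N + 1 := by exact_mod_cast h2
            omega
          exact h1.trans_le (by exact_mod_cast h3)
    ext1 i
    have h1 : (Q i).divX = 0 := by simpa [D] using DFunLike.congr_fun hD i
    have h2 : (Q i).coeff 0 = 0 := by
      rw [← Finsupp.mapRange_apply (f := fun P : Polynomial B => P.coeff 0) (hf := by simp)]
      exact DFunLike.congr_fun hq i
    rw [← Polynomial.divX_mul_X_add (Q i), h1, h2]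
    simp

open Pointwise in
theorem aeval_sum_smul_eq_zero {k A ι : Type*} [Field k] [CommRing A] [Algebra k A] {m : ℕ}
    {M : Type*} [AddCommGroup M] [Module A M] (f : Fin m → A)
    (hf : RingTheory.Sequence.IsWeaklyRegular M (List.ofFn f)) (b : ι → M)
    (hb : ∀ c : ι →₀ k, (c.sum fun i a => algebraMap k A a • b i) ∈
      Ideal.ofList (List.ofFn f) • (⊤ : Submodule A M) → c = 0)
    (p : ι →₀ MvPolynomial (Fin m) k) (hp : (p.sum fun i q => aeval f q • b i) = 0) : p = 0 := by
  induction m generalizing M with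
  | zero =>
    let c : ι →₀ k := p.mapRange (isEmptyAlgEquiv k (Fin 0)) (by simp)
    have hpc : ∀ i, p i = C (c i) := fun i => by
      rw [Finsupp.mapRange_apply]
      exact ((isEmptyAlgEquiv k (Fin 0)).symm_apply_apply (p i)).symm
    have hc : c = 0 := by
      apply hb
      have : (c.sum fun i a => algebraMap k A a • b i) = 0 := by
        rw [← hp, Finsupp.sum_mapRange_index (by simp)]
        refine Finsupp.sum_congr fun i _ => ?_
        conv_rhs => rw [hpc i]
        simp [c]
      rw [this]
      exact zero_mem _
    ext1 i
    simp [hpc i, hc]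
  | succ m ih =>
    rw [List.ofFn_succ, RingTheory.Sequence.isWeaklyRegular_cons_iff] at hf
    have key := eval₂_sum_smul_eq_zero (aeval (R := k) (fun i => f (Fin.succ i))).toRingHom (f 0)
      hf.1 b (fun q hq => ih (M := QuotSMulTop (f 0) M) (fun i => f (Fin.succ i)) hf.2
        (fun i => Submodule.Quotient.mk (b i)) (fun c hc => hb c ?_) q ?_)
      (p.mapRange (finSuccEquiv k m) (by simp)) ?_
    · ext1 i
      simpa using DFunLike.congr_fun key i
    · rw [List.ofFn_succ, Ideal.ofList_cons, Submodule.sup_smul]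
      have hmap : (Ideal.ofList (List.ofFn fun i => f (Fin.succ i)) •
          (⊤ : Submodule A (QuotSMulTop (f 0) M))) =
          Submodule.map (Submodule.mkQ _) (Ideal.ofList (List.ofFn fun i => f (Fin.succ i)) •
          (⊤ : Submodule A M)) := by
        rw [Submodule.map_smul'', Submodule.map_top, Submodule.range_mkQ]
      rw [hmap] at hc
      obtain ⟨y, hy, hyc⟩ := hc
      have : (c.sum fun i a => algebraMap k A a • b i) - y ∈ f 0 • (⊤ : Submodule A M) := by
        rw [← Submodule.Quotient.mk_eq_zero, Submodule.Quotient.mk_sub, sub_eq_zero]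
        rw [Submodule.mkQ_apply] at hyc
        rw [hyc, Finsupp.sum, Finsupp.sum, ← Submodule.mkQ_apply, map_sum]
        rfl
      rw [Submodule.ideal_span_singleton_smul]
      have h2 := Submodule.add_mem_sup this hy
      rwa [sub_add_cancel] at h2
    · rw [← (Submodule.Quotient.mk_eq_zero _).mpr hq, Finsupp.sum, Finsupp.sum,
        ← Submodule.mkQ_apply, map_sum]
      rfl
    · rw [← hp, Finsupp.sum_mapRange_index (by simp)]
      refine Finsupp.sum_congr fun i _ => ?_
      congr 1
      conv_rhs => rw [← (finSuccEquiv k m).symm_apply_apply (p i)]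
      generalize finSuccEquiv k m (p i) = P
      have : (Polynomial.eval₂RingHom (aeval (R := k) (fun i => f (Fin.succ i))).toRingHom (f 0)).comp
          (finSuccEquiv k m).toRingEquiv.toRingHom = (aeval f).toRingHom := by
        apply MvPolynomial.ringHom_ext
        · intro a
          simp [finSuccEquiv_apply]
        · intro i
          refine Fin.cases ?_ (fun j => ?_) i <;> simp [finSuccEquiv_X_zero, finSuccEquiv_X_succ]
      have h2 := RingHom.congr_fun this ((finSuccEquiv k m).symm P)
      simpa using h2

theorem homogeneousComponent_mul_of_isHomogeneous {σ k : Type*} [CommRing k]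
    {f : MvPolynomial σ k} {d : ℕ} (hf : f.IsHomogeneous d) (D : ℕ) (r : MvPolynomial σ k) :
    homogeneousComponent D (r * f) =
      if d ≤ D then homogeneousComponent (D - d) r * f else 0 := by
  induction r using MvPolynomial.induction_on' with
  | add p q hp hq =>
    rw [add_mul, map_add, hp, hq, map_add]
    split_ifs <;> ring
  | monomial u a =>
    have h1 : (monomial u a).IsHomogeneous u.degree := isHomogeneous_monomial a rfl
    rw [homogeneousComponent_of_mem ((mem_homogeneousSubmodule _ _).mpr (h1.mul hf)),
      homogeneousComponent_of_mem ((mem_homogeneousSubmodule _ _).mpr h1)]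
    split_ifs <;> first | rfl | omega

theorem free_of_isRegular_isHomogeneous {k σ : Type*} [Field k] {s : ℕ}
    (f : Fin s → MvPolynomial σ k) (d : Fin s → ℕ) (hd : ∀ i, 0 < d i)
    (hdeg : ∀ i, (f i).IsHomogeneous (d i))
    (hreg : RingTheory.Sequence.IsWeaklyRegular (MvPolynomial σ k) (List.ofFn f)) :
    letI := (aeval (R := k) f).toRingHom.toAlgebra
    Module.Free (MvPolynomial (Fin s) k) (MvPolynomial σ k) := by
  let _ := (aeval (R := k) f).toRingHom.toAlgebra
  let F : Ideal (MvPolynomial σ k) := Ideal.ofList (List.ofFn f)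
  obtain ⟨κ, a, -, hspan, hind⟩ := exists_linearIndependent' k
    (fun u : σ →₀ ℕ => Ideal.Quotient.mkₐ k F (monomial u (1 : k)))
  let b : κ → MvPolynomial σ k := fun j => monomial (a j) 1
  have hspan' : Submodule.span k (Set.range b) ⊔ F.restrictScalars k = ⊤ := by
    rw [eq_top_iff]
    intro p _
    have hp : Ideal.Quotient.mkₐ k F p ∈ Submodule.span k
        (Set.range ((fun u : σ →₀ ℕ => Ideal.Quotient.mkₐ k F (monomial u (1 : k))) ∘ a)) := by
      rw [hspan, p.as_sum, map_sum]
      refine Submodule.sum_mem _ fun u _ => ?_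
      rw [← mul_one (coeff u p), ← smul_eq_mul, ← smul_monomial, map_smul]
      exact Submodule.smul_mem _ _ (Submodule.subset_span ⟨u, rfl⟩)
    have hrange : Set.range ((fun u : σ →₀ ℕ => Ideal.Quotient.mkₐ k F (monomial u (1 : k))) ∘ a) =
        (Ideal.Quotient.mkₐ k F).toLinearMap '' Set.range b := by
      rw [← Set.range_comp]
      rfl
    rw [hrange, ← Submodule.map_span] at hp
    obtain ⟨x, hx, hxp⟩ := hp
    refine Submodule.mem_sup.mpr ⟨x, hx, p - x, ?_, by ring⟩
    exact Ideal.Quotient.eq.mp hxp.symm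
  have hli : LinearIndependent (MvPolynomial (Fin s) k) b := by
    rw [linearIndependent_iff]
    intro p hp
    refine aeval_sum_smul_eq_zero f hreg b (fun c hc => ?_) p hp
    rw [linearIndependent_iff] at hind
    apply hind
    rw [Finsupp.linearCombination_apply]
    have hc' : (c.sum fun i a => algebraMap k (MvPolynomial σ k) a • b i) ∈ F := by
      simpa using hc
    rw [← Ideal.Quotient.eq_zero_iff_mem, Finsupp.sum, map_sum] at hc'
    rw [← hc', Finsupp.sum]
    refine Finset.sum_congr rfl fun i _ => ?_
    rw [Function.comp_apply, ← map_smul, ← algebraMap_smul (MvPolynomial σ k)]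
    rfl
  have htop : ⊤ ≤ Submodule.span (MvPolynomial (Fin s) k) (Set.range b) := by
    set N := Submodule.span (MvPolynomial (Fin s) k) (Set.range b)
    have hC : ∀ (c : k) (x), x ∈ N → c • x ∈ N := fun c x hx => by
      have := N.smul_mem (C c) hx
      rwa [Algebra.smul_def, RingHom.algebraMap_toAlgebra, AlgHom.toRingHom_eq_coe,
        RingHom.coe_coe, aeval_C, ← Algebra.smul_def] at this
    have hf : ∀ i, ∀ x ∈ N, x * f i ∈ N := fun i x hx => by
      have := N.smul_mem (X i) hx
      rwa [Algebra.smul_def, RingHom.algebraMap_toAlgebra, AlgHom.toRingHom_eq_coe,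
        RingHom.coe_coe, aeval_X, mul_comm] at this
    have hhom : ∀ D : ℕ, ∀ p : MvPolynomial σ k, homogeneousComponent D p ∈ N := by
      intro D
      induction D using Nat.strong_induction_on with
      | _ D ih =>
      intro p
      have hp : p ∈ Submodule.span k (Set.range b) ⊔ F.restrictScalars k := by
        rw [hspan']; trivial
      obtain ⟨x, hx, y, hy, rfl⟩ := Submodule.mem_sup.mp hp
      rw [map_add]
      refine N.add_mem ?_ ?_
      · induction hx using Submodule.span_induction with
        | mem x hx =>
          obtain ⟨j, rfl⟩ := hx
          rw [homogeneousComponent_of_mem ((mem_homogeneousSubmodule _ _).mpr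
            (isHomogeneous_monomial (1 : k) rfl))]
          split_ifs
          · exact Submodule.subset_span ⟨j, rfl⟩
          · exact zero_mem _
        | zero => rw [map_zero]; exact zero_mem _
        | add x y _ _ hx hy =>
          rw [map_add]
          exact N.add_mem (hx (by rw [hspan']; trivial)) (hy (by rw [hspan']; trivial))
        | smul c x _ hx => rw [map_smul]; exact hC c _ (hx (by rw [hspan']; trivial))
      · have hy' : y ∈ Ideal.span (Set.range f) := by
          have : F = Ideal.span (Set.range f) := by
            simp [F, Ideal.ofList, Set.range, List.mem_ofFn]
          rw [← this]; exact hy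
        obtain ⟨r, rfl⟩ := (Ideal.mem_span_range_iff_exists_fun).mp hy'
        rw [map_sum]
        refine N.sum_mem fun i _ => ?_
        rw [homogeneousComponent_mul_of_isHomogeneous (hdeg i)]
        split_ifs with h
        · exact hf i _ (ih _ (by have := hd i; omega) _)
        · exact zero_mem _
    intro p _
    rw [← sum_homogeneousComponent p]
    exact N.sum_mem fun i _ => hhom i p
  exact Module.Free.of_basis (Module.Basis.mk hli htop)

theorem Ideal.isMaximal_under_of_finiteType (k : Type*) {A B : Type*} [Field k] [CommRing A]
    [CommRing B] [Algebra k A] [Algebra k B] [Algebra A B] [IsScalarTower k A B]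
    [Algebra.FiniteType k B] (Q : Ideal B) [Q.IsMaximal] : (Q.under A).IsMaximal := by
  let := Ideal.Quotient.field Q
  have : Module.Finite k (B ⧸ Q) := finite_of_finite_type_of_isJacobsonRing k (B ⧸ Q)
  have : Algebra.IsIntegral A (B ⧸ Q) := Algebra.IsIntegral.tower_top (R := k)
  have h := Ideal.isMaximal_comap_of_isIntegral_of_isMaximal (R := A) (S := B ⧸ Q) ⊥
  rwa [IsScalarTower.algebraMap_eq A B (B ⧸ Q), ← Ideal.comap_comap,
    Ideal.Quotient.algebraMap_eq, ← RingHom.ker_eq_comap_bot, Ideal.mk_ker] at h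

theorem MvPolynomial.height_of_isMaximal {k : Type*} [Field k] {m : ℕ}
    (Q : Ideal (MvPolynomial (Fin m) k)) [Q.IsMaximal] : Q.height = m := by
  induction m with
  | zero =>
    have e := (MvPolynomial.isEmptyAlgEquiv k (Fin 0)).toRingEquiv
    have : IsField (MvPolynomial (Fin 0) k) := e.toMulEquiv.isField (Field.toIsField k)
    let := this.toField
    rw [Ideal.eq_bot_of_prime Q]
    simp
  | succ m ih =>
    let e := (finSuccEquiv k m).toRingEquiv
    let P := Q.map e
    have hP : P.IsMaximal := Ideal.map_isMaximal_of_equiv e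
    have hp : (P.under (MvPolynomial (Fin m) k)).IsMaximal :=
      Polynomial.isMaximal_comap_C_of_isJacobsonRing P
    have : P.LiesOver (P.under (MvPolynomial (Fin m) k)) := ⟨rfl⟩
    rw [← RingEquiv.height_map e Q,
      Polynomial.height_eq_height_add_one (P.under (MvPolynomial (Fin m) k)) P, ih]
    simp

theorem Ideal.height_map_eq_of_surjective {A B : Type*} [CommRing A] [CommRing B] (π : A →+* B)
    (hπ : Function.Surjective π) (K : Ideal A) (hK : RingHom.ker π = K) (Q : Ideal A) :
    (Q.map π).height = (Q.map (Ideal.Quotient.mk K)).height := by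
  subst hK
  let e := RingHom.quotientKerEquivOfSurjective hπ
  have he : (e : A ⧸ RingHom.ker π →+* B).comp (Ideal.Quotient.mk (RingHom.ker π)) = π :=
    RingHom.ext fun _ => rfl
  have h := RingEquiv.height_map e (Q.map (Ideal.Quotient.mk (RingHom.ker π)))
  rwa [← Ideal.map_coe e, Ideal.map_map, he] at h

theorem ringKrullDim_eq_add_of_faithfullyFlat {A B : Type*} [CommRing A] [CommRing B]
    [IsNoetherianRing A] [IsNoetherianRing B] [FiniteRingKrullDim A] [Algebra A B]
    [Module.FaithfullyFlat A B] (h : ℕ∞)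
    (hmax : ∀ Q : Ideal B, Q.IsMaximal → (Q.under A).IsMaximal)
    (hfib : ∀ Q : Ideal B, Q.IsMaximal →
      (Q.map (Ideal.Quotient.mk ((Q.under A).map (algebraMap A B)))).height = h) :
    ringKrullDim B = ringKrullDim A + h := by
  have key (Q : Ideal B) (hQ : Q.IsMaximal) : Q.height = (Q.under A).height + h := by
    have := hmax Q hQ
    rw [Ideal.height_eq_height_add_of_liesOver_of_hasGoingDown (Q.under A) Q, hfib Q hQ]
  apply le_antisymm
  · rw [ringKrullDim_le_iff_isMaximal_height_le]
    intro Q hQ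
    rw [key Q hQ, WithBot.coe_add]
    gcongr
    exact Ideal.height_le_ringKrullDim_of_ne_top (hmax Q hQ).ne_top
  · obtain ⟨p, hp, hpA⟩ := Ideal.exists_isMaximal_height (R := A)
    obtain ⟨P, hP, hPp⟩ := Ideal.exists_isPrime_liesOver_of_faithfullyFlat (B := B) p
    obtain ⟨Q, hQ, hPQ⟩ := P.exists_le_maximal hP.ne_top
    have hQp : Q.under A = p :=
      (hp.eq_of_le (hmax Q hQ).ne_top (hPp.over.trans_le (Ideal.comap_mono hPQ))).symm
    rw [← hpA, ← hQp, ← WithBot.coe_add, ← key Q hQ]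
    exact Ideal.height_le_ringKrullDim_of_ne_top hQ.ne_top

theorem Ideal.faithfullyFlat_quotient_map {A B : Type*} [CommRing A] [CommRing B]
    [Algebra A B] [Module.FaithfullyFlat A B] (I : Ideal A) :
    Module.FaithfullyFlat (A ⧸ I) (B ⧸ I.map (algebraMap A B)) :=
  .of_linearEquiv _ _ (Algebra.TensorProduct.quotIdealMapEquivQuotTensor B I).toLinearEquiv

theorem ringKrullDim_quotient_map_of_faithfullyFlat (k : Type*) {S R : Type*} [Field k] [CommRing S]
    [CommRing R] [Nontrivial R] [Algebra k S] [Algebra k R] [Algebra S R] [IsScalarTower k S R]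
    [Algebra.FiniteType k R] [IsNoetherianRing S] [IsNoetherianRing R] [FiniteRingKrullDim S]
    [Module.FaithfullyFlat S R] {s m : ℕ} (hS : ∀ Q : Ideal S, Q.IsMaximal → Q.height = s)
    (hR : ∀ Q : Ideal R, Q.IsMaximal → Q.height = m) :
    s ≤ m ∧ ∀ I : Ideal S, I ≠ ⊤ →
      ringKrullDim (R ⧸ I.map (algebraMap S R)) = ringKrullDim (S ⧸ I) + (m - s : ℕ) := by
  have hfib (Q : Ideal R) (hQ : Q.IsMaximal) : (m : ℕ∞) =
      s + (Q.map (Ideal.Quotient.mk ((Q.under S).map (algebraMap S R)))).height := by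
    have hP : (Q.under S).IsMaximal := Ideal.isMaximal_under_of_finiteType k Q
    rw [← hR Q hQ, ← hS (Q.under S) hP]
    exact Ideal.height_eq_height_add_of_liesOver_of_hasGoingDown (Q.under S) Q
  have hsm : s ≤ m := by
    obtain ⟨Q, hQ⟩ := Ideal.exists_maximal R
    exact_mod_cast le_self_add.trans_eq (hfib Q hQ).symm
  refine ⟨hsm, fun I hI => ?_⟩
  have : Nontrivial (S ⧸ I) := Ideal.Quotient.nontrivial_iff.mpr hI
  have : FiniteRingKrullDim (S ⧸ I) := by
    rw [finiteRingKrullDim_iff_ne_bot_and_top]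
    refine ⟨fun h => (h ▸ ringKrullDim_nonneg_of_nontrivial).not_gt (WithBot.bot_lt_coe _),
      fun h => ?_⟩
    have := ringKrullDim_quotient_le I
    rw [h, top_le_iff] at this
    exact (finiteRingKrullDim_iff_ne_bot_and_top.mp ‹_›).2 this
  have := Ideal.faithfullyFlat_quotient_map (B := R) I
  rw [ringKrullDim_eq_add_of_faithfullyFlat (A := S ⧸ I) (B := R ⧸ I.map (algebraMap S R))
    (m - s : ℕ)]
  · rfl
  · intro Q hQ
    have : IsScalarTower k (S ⧸ I) (R ⧸ I.map (algebraMap S R)) := by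
      refine IsScalarTower.of_algebraMap_eq fun c => ?_
      change Ideal.Quotient.mk _ (algebraMap k R c) =
        Ideal.Quotient.mk _ (algebraMap S R (algebraMap k S c))
      rw [← IsScalarTower.algebraMap_apply]
    exact Ideal.isMaximal_under_of_finiteType k Q
  · intro Q hQ
    let π : R →+* R ⧸ I.map (algebraMap S R) := Ideal.Quotient.mk _
    have hπ : Function.Surjective π := Ideal.Quotient.mk_surjective
    let Q' := Q.comap π
    have hQ' : Q'.IsMaximal := Ideal.comap_isMaximal_of_surjective π hπ
    have hQQ : Q'.map π = Q := Ideal.map_comap_of_surjective π hπ Q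
    have hu : (Q.under (S ⧸ I)).map (algebraMap (S ⧸ I) (R ⧸ I.map (algebraMap S R))) =
        ((Q'.under S).map (algebraMap S R)).map π := by
      have hc : (algebraMap (S ⧸ I) (R ⧸ I.map (algebraMap S R))).comp (Ideal.Quotient.mk I) =
          π.comp (algebraMap S R) := rfl
      have hQ'S : Q'.under S = (Q.under (S ⧸ I)).comap (Ideal.Quotient.mk I) := rfl
      rw [Ideal.map_map, ← hc, ← Ideal.map_map, hQ'S,
        Ideal.map_comap_of_surjective _ Ideal.Quotient.mk_surjective]
    have hle : I.map (algebraMap S R) ≤ (Q'.under S).map (algebraMap S R) := by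
      refine Ideal.map_mono fun a ha => ?_
      have : π (algebraMap S R a) = 0 :=
        Ideal.Quotient.eq_zero_iff_mem.mpr (Ideal.mem_map_of_mem _ ha)
      change π (algebraMap S R a) ∈ Q
      rw [this]
      exact Q.zero_mem
    have h1 := hfib Q' hQ'
    rw [← Ideal.height_map_eq_of_surjective ((Ideal.Quotient.mk
      ((Q.under (S ⧸ I)).map (algebraMap (S ⧸ I) (R ⧸ I.map (algebraMap S R))))).comp π)
      (by rw [RingHom.coe_comp]; exact Ideal.Quotient.mk_surjective.comp hπ), ← Ideal.map_map,
      hQQ] at h1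
    · have h2 : ((s : ℕ∞) + (m - s : ℕ)) = m := by exact_mod_cast Nat.add_sub_of_le hsm
      rw [← h2] at h1
      exact (ENat.add_right_injective_of_ne_top (ENat.natCast_ne_top s) h1).symm
    · rw [← RingHom.comap_ker, Ideal.mk_ker, hu, Ideal.comap_map_of_surjective π hπ,
        ← RingHom.ker_eq_comap_bot, Ideal.mk_ker]
      exact sup_eq_left.mpr hle

open TensorProduct in
/-- For an `R`-module `X`, the canonical isomorphism `(S ⧸ I) ⊗[S] X ≃ (R ⧸ I R) ⊗[R] X`. -/
noncomputable def quotTensorEquivQuotMapTensor {S R : Type*} [CommRing S] [CommRing R]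
    [Algebra S R] (I : Ideal S) (X : Type*) [AddCommGroup X] [Module S X] [Module R X]
    [IsScalarTower S R X] :
    (S ⧸ I) ⊗[S] X ≃ₗ[S] (R ⧸ I.map (algebraMap S R)) ⊗[R] X :=
  TensorProduct.comm S _ _ ≪≫ₗ
    ((AlgebraTensorModule.cancelBaseChange S R R X (S ⧸ I)).symm ≪≫ₗ
      TensorProduct.congr (LinearEquiv.refl R X)
        (Algebra.TensorProduct.quotIdealMapEquivTensorQuot R I).symm.toLinearEquiv ≪≫ₗ
      TensorProduct.comm R _ _).restrictScalars S

open TensorProduct in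
theorem quotTensorEquivQuotMapTensor_tmul {S R : Type*} [CommRing S] [CommRing R]
    [Algebra S R] (I : Ideal S) (X : Type*) [AddCommGroup X] [Module S X] [Module R X]
    [IsScalarTower S R X] (a : S) (x : X) :
    quotTensorEquivQuotMapTensor (R := R) I X (Ideal.Quotient.mk I a ⊗ₜ x) =
      Ideal.Quotient.mk _ (algebraMap S R a) ⊗ₜ x := by
  change Submodule.Quotient.mk (a • (1 : R)) ⊗ₜ x = _
  rw [← Algebra.algebraMap_eq_smul_one]
  rfl

section
variable {S R : Type} [CommRing S] [CommRing R] [Algebra S R]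

open MonoidalCategory TensorProduct

/-- The components of `restrictScalarsCompTensorIso`. -/
noncomputable def restrictScalarsTensorEquiv (I : Ideal S) (X : ModuleCat R) :
    (ModuleCat.of S (S ⧸ I) ⊗ (ModuleCat.restrictScalars (algebraMap S R)).obj X :
      ModuleCat S) ≃ₗ[S]
    ((ModuleCat.restrictScalars (algebraMap S R)).obj
      (ModuleCat.of R (R ⧸ I.map (algebraMap S R)) ⊗ X) : ModuleCat S) :=
  letI : Module S X := Module.compHom X (algebraMap S R)
  haveI : IsScalarTower S R X := ⟨fun a b x => by rw [Algebra.smul_def, mul_smul]; rfl⟩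
  AddEquiv.toLinearEquiv (quotTensorEquivQuotMapTensor (R := R) I X).toAddEquiv fun a t =>
    ((quotTensorEquivQuotMapTensor (R := R) I X).map_smul a t).trans
      (algebraMap_smul R a (quotTensorEquivQuotMapTensor (R := R) I X t)).symm

theorem restrictScalarsTensorEquiv_tmul (I : Ideal S) (X : ModuleCat R) (a : S) (x : X) :
    restrictScalarsTensorEquiv I X (Ideal.Quotient.mk I a ⊗ₜ x) =
      (Ideal.Quotient.mk (I.map (algebraMap S R)) (algebraMap S R a) ⊗ₜ[R] x :
        (R ⧸ I.map (algebraMap S R)) ⊗[R] X) := by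
  let : Module S X := Module.compHom X (algebraMap S R)
  have : IsScalarTower S R X := ⟨fun a b x => by rw [Algebra.smul_def, mul_smul]; rfl⟩
  have := quotTensorEquivQuotMapTensor_tmul (R := R) I X a x
  exact this

/-- The functors `X ↦ (S ⧸ I) ⊗[S] X` and `X ↦ (R ⧸ I R) ⊗[R] X` on `R`-modules agree. -/
noncomputable def restrictScalarsCompTensorIso (I : Ideal S) :
    ModuleCat.restrictScalars (algebraMap S R) ⋙
        (tensoringLeft (ModuleCat S)).obj (ModuleCat.of S (S ⧸ I)) ≅
      (tensoringLeft (ModuleCat R)).obj (ModuleCat.of R (R ⧸ I.map (algebraMap S R))) ⋙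
        ModuleCat.restrictScalars (algebraMap S R) :=
  NatIso.ofComponents (fun X => (restrictScalarsTensorEquiv I X).toModuleIso)
    fun {X Y} g => by
      ext t
      induction t using TensorProduct.induction_on with
      | zero => rw [map_zero, map_zero]
      | add x y hx hy => rw [map_add, map_add, hx, hy]
      | tmul a x =>
        obtain ⟨a, rfl⟩ := Ideal.Quotient.mk_surjective a
        exact (restrictScalarsTensorEquiv_tmul I Y a (g x)).trans (congrArg
          ((ModuleCat.restrictScalars (algebraMap S R)).map
            (ModuleCat.of R (R ⧸ I.map (algebraMap S R)) ◁ g))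
          (restrictScalarsTensorEquiv_tmul I X a x).symm)

theorem restrictScalars_preservesProjectiveObjects [Module.Free S R] :
    (ModuleCat.restrictScalars (algebraMap S R)).PreservesProjectiveObjects where
  projective_obj {X} hX := by
    let : Module S X := Module.compHom X (algebraMap S R)
    have : IsScalarTower S R X := ⟨fun a b x => by
      rw [Algebra.smul_def, mul_smul]; rfl⟩
    obtain ⟨σ, hσ⟩ := ((IsProjective.iff_projective X).mpr hX).out
    have hX' : Module.Projective S X := Module.Projective.of_split (M := X →₀ R)
      (σ.restrictScalars S) ((Finsupp.linearCombination R id).restrictScalars S)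
      (LinearMap.ext hσ)
    exact (IsProjective.iff_projective _).mp hX'

/-- For `R` free over `S`, the `Tor` over `S` of `S ⧸ I` and a restricted module `N` is the `Tor`
over `R` of `R ⧸ I R` and `N`. -/
noncomputable def torRestrictScalarsIso [Module.Free S R] (I : Ideal S) (N : ModuleCat R) (i : ℕ) :
    ((Tor (ModuleCat S) i).obj (ModuleCat.of S (S ⧸ I))).obj
        ((ModuleCat.restrictScalars (algebraMap S R)).obj N) ≅
      (ModuleCat.restrictScalars (algebraMap S R)).obj
        (((Tor (ModuleCat R) i).obj (ModuleCat.of R (R ⧸ I.map (algebraMap S R)))).obj N) :=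
  letI := restrictScalars_preservesProjectiveObjects (S := S) (R := R)
  let P := projectiveResolution N
  let F := ModuleCat.restrictScalars (algebraMap S R)
  (F.mapProjectiveResolution P).isoLeftDerivedObj _ i ≪≫
    (HomologicalComplex.homologyFunctor _ _ i).mapIso
      ((NatIso.mapHomologicalComplex (restrictScalarsCompTensorIso I) _).app P.complex) ≪≫
    ShortComplex.mapHomologyIso
      (((((tensoringLeft (ModuleCat R)).obj
        (ModuleCat.of R (R ⧸ I.map (algebraMap S R)))).mapHomologicalComplex _).obj
          P.complex).sc i) F ≪≫
    F.mapIso (P.isoLeftDerivedObj _ i).symm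

theorem torRank_eq_torRank_map (k : Type) [Field k] [Algebra k S] [Algebra k R]
    [IsScalarTower k S R] [Module.Free S R] (I : Ideal S) {N N' : Type} [AddCommGroup N]
    [Module S N] [AddCommGroup N'] [Module R N'] (e : N ≃+ N')
    (he : ∀ (a : S) (x : N), e (a • x) = algebraMap S R a • e x) (i : ℕ) :
    torRank k S (S ⧸ I) N i = torRank k R (R ⧸ I.map (algebraMap S R)) N' i := by
  let e' : N ≃ₗ[S] (ModuleCat.restrictScalars (algebraMap S R)).obj (ModuleCat.of R N') :=
    AddEquiv.toLinearEquiv e he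
  let E := (((Tor (ModuleCat S) i).obj (ModuleCat.of S (S ⧸ I))).mapIso e'.toModuleIso ≪≫
    torRestrictScalarsIso I (ModuleCat.of R N') i).toLinearEquiv
  refine LinearEquiv.rank_eq (AddEquiv.toLinearEquiv (E.toAddEquiv : RestrictScalars k S
    (((Tor (ModuleCat S) i).obj (ModuleCat.of S (S ⧸ I))).obj (ModuleCat.of S N)) ≃+
    RestrictScalars k R (((Tor (ModuleCat R) i).obj
      (ModuleCat.of R (R ⧸ I.map (algebraMap S R)))).obj (ModuleCat.of R N'))) fun c x => ?_)
  refine (E.map_smul (algebraMap k S c) x).trans ?_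
  rw [RestrictScalars.smul_def, IsScalarTower.algebraMap_apply k S R]
  rfl

end

open Limits in
theorem CategoryTheory.Functor.isZero_leftDerived_of_hasProjectiveDimensionLT {C D : Type*}
    [Category* C] [Abelian C] [HasProjectiveResolutions C] [Category* D] [Abelian D]
    (F : C ⥤ D) [F.Additive] (X : C) (i : ℕ) [HasProjectiveDimensionLT X (i + 1)] :
    IsZero ((F.leftDerived (i + 1)).obj X) := by
  let P := projectiveResolution X
  let := HasExt.standard C
  let p := factorThruImage (P.complex.d (i + 1) i)
  have hp : P.complex.d (i + 2) (i + 1) ≫ p = 0 := by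
    rw [← cancel_mono (image.ι _), Category.assoc, image.fac, P.complex.d_comp_d, zero_comp]
  obtain ⟨g, hg⟩ := (P.extMk_eq_zero_iff p (i + 2) rfl hp i rfl).mp
    ((HasProjectiveDimensionLT.subsingleton X (i + 1) _ le_rfl _).elim _ _)
  let s := Projective.factorThru g p
  have hs : P.complex.d (i + 1) i ≫ s ≫ P.complex.d (i + 1) i = P.complex.d (i + 1) i := by
    have : P.complex.d (i + 1) i = p ≫ image.ι _ := (image.fac _).symm
    conv_lhs => enter [2, 2]; rw [this]
    rw [Projective.factorThru_comp_assoc, ← Category.assoc, hg, ← this]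
  let t : P.complex.X (i + 1) ⟶ P.complex.X (i + 2) :=
    (P.exact_succ i).liftFromProjective (𝟙 _ - P.complex.d (i + 1) i ≫ s) (by simp [hs])
  have ht : t ≫ P.complex.d (i + 2) (i + 1) = 𝟙 _ - P.complex.d (i + 1) i ≫ s :=
    (P.exact_succ i).liftFromProjective_comp _ _
  have htF : F.map t ≫ F.map (P.complex.d (i + 2) (i + 1)) =
      𝟙 _ - F.map (P.complex.d (i + 1) i) ≫ F.map s := by
    rw [← F.map_comp, ht]
    simp
  refine IsZero.of_iso ?_ (P.isoLeftDerivedObj F (i + 1))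
  refine (HomologicalComplex.exactAt_iff_isZero_homology _ _).mp ?_
  rw [HomologicalComplex.exactAt_iff' _ (i + 2) (i + 1) i (by simp) (by simp),
    ShortComplex.exact_iff_exact_up_to_refinements]
  intro A (x : A ⟶ F.obj (P.complex.X (i + 1)))
    (hx : x ≫ F.map (P.complex.d (i + 1) i) = 0)
  have key : x = (x ≫ F.map t) ≫ F.map (P.complex.d (i + 2) (i + 1)) := by
    rw [Category.assoc, htF, Preadditive.comp_sub, ← Category.assoc, hx, zero_comp]
    simp
  exact ⟨A, 𝟙 A, inferInstance, x ≫ F.map t, (Category.id_comp x).trans key⟩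

section
variable {A : Type} [CommRing A] {κ : ModuleCat.{0} A} (P : ProjectiveResolution κ)

open MonoidalCategory Limits

/-- The complex `M ⊗ P`, as a functor of `M`. -/
noncomputable def tensorResolution : ModuleCat.{0} A ⥤ ChainComplex (ModuleCat.{0} A) ℕ where
  obj M := (((tensoringLeft (ModuleCat A)).obj M).mapHomologicalComplex _).obj P.complex
  map f := (NatTrans.mapHomologicalComplex ((tensoringLeft (ModuleCat A)).map f) _).app P.complex

instance : (tensorResolution P).Additive where
  map_add {M N f g} := by
    ext i : 1
    exact (tensorRight (P.complex.X i)).map_add (f := f) (g := g)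

theorem tensorResolution_map_shortExact {S : ShortComplex (ModuleCat.{0} A)} (hS : S.ShortExact) :
    (S.map (tensorResolution P)).ShortExact := by
  refine HomologicalComplex.shortExact_of_degreewise_shortExact _ fun i => ?_
  change (S.map (tensorRight (P.complex.X i))).ShortExact
  have : Module.Projective A (P.complex.X i) :=
    (IsProjective.iff_projective _).mpr (P.projective i)
  have := (Module.Flat.iff_preservesFiniteLimits_tensorRight (P.complex.X i)).mp inferInstance
  exact hS.map_of_exact _

theorem isZero_tor_iff (M : ModuleCat.{0} A) (i : ℕ) :
    IsZero (((Tor (ModuleCat A) i).obj M).obj κ) ↔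
      IsZero (((tensorResolution P).obj M).homology i) :=
  (P.isoLeftDerivedObj ((tensoringLeft (ModuleCat A)).obj M) i).isZero_iff

theorem homologyMap_tensorResolution_smul (M : ModuleCat.{0} A) (r : A) (hr : r • 𝟙 κ = 0) (i : ℕ) :
    HomologicalComplex.homologyMap ((tensorResolution P).map (r • 𝟙 M)) i = 0 := by
  have hcomm : (r • 𝟙 P.complex) ≫ P.π = 0 := by
    ext : 1
    have h (φ : P.complex.X 0 ⟶ κ) : (r • 𝟙 (P.complex.X 0)) ≫ φ = 0 := by
      rw [Linear.smul_comp, Category.id_comp, ← Category.comp_id φ, ← Linear.comp_smul, hr,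
        comp_zero]
    exact h (P.π.f 0)
  have h : (tensorResolution P).map (r • 𝟙 M) =
      (((tensoringLeft (ModuleCat A)).obj M).mapHomologicalComplex _).map (r • 𝟙 P.complex) := by
    ext i : 1
    change (r • 𝟙 M) ▷ P.complex.X i = M ◁ (r • 𝟙 (P.complex.X i))
    simp
  have h₀ := Homotopy.homologyMap_eq (((tensoringLeft (ModuleCat A)).obj M).mapHomotopy
    (ProjectiveResolution.liftHomotopyZero _ hcomm)) i
  rw [Functor.map_zero, HomologicalComplex.homologyMap_zero] at h₀
  exact (congrArg (HomologicalComplex.homologyMap · i) h).trans h₀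

theorem isZero_tor_of_shortExact {S : ShortComplex (ModuleCat.{0} A)} (hS : S.ShortExact) {i : ℕ}
    (h₃ : IsZero (((Tor (ModuleCat A) (i + 1)).obj S.X₃).obj κ))
    (h₂ : IsZero (((Tor (ModuleCat A) i).obj S.X₂).obj κ)) :
    IsZero (((Tor (ModuleCat A) i).obj S.X₁).obj κ) := by
  let P := projectiveResolution κ
  rw [isZero_tor_iff P] at h₂ h₃ ⊢
  exact ((tensorResolution_map_shortExact P hS).homology_exact₁ (i + 1) i (by simp)).isZero_X₂
    (h₃.eq_of_src _ _) (h₂.eq_of_tgt _ _)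

theorem isZero_tor_quotSMulTop_iff {M : ModuleCat.{0} A} {r : A} (hr : r • 𝟙 κ = 0)
    (hM : IsSMulRegular M r) (i : ℕ) :
    IsZero (((Tor (ModuleCat A) (i + 1)).obj (ModuleCat.of A (QuotSMulTop r M))).obj κ) ↔
      IsZero (((Tor (ModuleCat A) (i + 1)).obj M).obj κ) ∧
        IsZero (((Tor (ModuleCat A) i).obj M).obj κ) := by
  let P := projectiveResolution κ
  have hS := tensorResolution_map_shortExact P hM.smulShortComplex_shortExact
  have h₀ := homologyMap_tensorResolution_smul P M r hr
  simp_rw [isZero_tor_iff P]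
  refine ⟨fun h => ⟨?_, ?_⟩, fun ⟨h₁, h₀⟩ => ?_⟩
  · exact (hS.homology_exact₂ (i + 1)).isZero_X₂ (h₀ _) (h.eq_of_tgt _ _)
  · exact (hS.homology_exact₁ (i + 1) i (by simp)).isZero_X₂ (h.eq_of_src _ _) (h₀ _)
  · exact (hS.homology_exact₃ (i + 1) i (by simp)).isZero_X₂ (h₁.eq_of_src _ _)
      (h₀.eq_of_tgt _ _)

/-- `a` is the largest index `i` for which `Tor i M κ` is nonzero. -/
def IsTorTop (κ M : ModuleCat.{0} A) (a : ℕ) : Prop :=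
  ¬ IsZero (((Tor (ModuleCat A) a).obj M).obj κ) ∧
    ∀ i, a < i → IsZero (((Tor (ModuleCat A) i).obj M).obj κ)

theorem IsTorTop.of_iso {M N : ModuleCat.{0} A} (e : M ≅ N) {a : ℕ} (h : IsTorTop κ M a) :
    IsTorTop κ N a :=
  ⟨fun h' => h.1 (h'.of_iso (((Tor (ModuleCat A) a).mapIso e).app κ)),
    fun i hi => (h.2 i hi).of_iso (((Tor (ModuleCat A) i).mapIso e.symm).app κ)⟩

theorem IsTorTop.quotSMulTop {M : ModuleCat.{0} A} {r : A} (hr : r • 𝟙 κ = 0)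
    (hM : IsSMulRegular M r) {a : ℕ} (h : IsTorTop κ M a) :
    IsTorTop κ (ModuleCat.of A (QuotSMulTop r M)) (a + 1) := by
  refine ⟨fun h' => h.1 ((isZero_tor_quotSMulTop_iff hr hM a).mp h').2, fun i hi => ?_⟩
  obtain ⟨j, rfl⟩ := Nat.exists_eq_succ_of_ne_zero (show i ≠ 0 by lia)
  exact (isZero_tor_quotSMulTop_iff hr hM j).mpr ⟨h.2 _ (by lia), h.2 _ (by lia)⟩

theorem IsTorTop.quot_ofList {rs : List A} (hrs : ∀ r ∈ rs, r • 𝟙 κ = 0) {a : ℕ}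
    {M : Type} [AddCommGroup M] [Module A M] (h : IsTorTop κ (ModuleCat.of A M) a)
    (hM : RingTheory.Sequence.IsWeaklyRegular M rs) :
    IsTorTop κ (ModuleCat.of A (M ⧸ (Ideal.ofList rs • ⊤ : Submodule A M))) (a + rs.length) := by
  induction rs generalizing M a with
  | nil =>
    refine h.of_iso (LinearEquiv.toModuleIso (Submodule.quotEquivOfEqBot _ ?_).symm)
    simp
  | cons r rs ih =>
    rw [RingTheory.Sequence.isWeaklyRegular_cons_iff] at hM
    have := ih (fun x hx => hrs x (List.mem_cons_of_mem _ hx))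
      (h.quotSMulTop (hrs r List.mem_cons_self) hM.1) hM.2
    rw [add_assoc, add_comm 1] at this
    exact this.of_iso
      (LinearEquiv.toModuleIso (Submodule.quotOfListConsSMulTopEquivQuotSMulTopInner M r rs).symm)

theorem isZero_tor_zero_iff (M : ModuleCat.{0} A) :
    IsZero (((Tor (ModuleCat A) 0).obj M).obj κ) ↔ Subsingleton (TensorProduct A M κ) := by
  refine (((tensoringLeft (ModuleCat A)).obj M).leftDerivedZeroIsoSelf.app κ).isZero_iff.trans ?_
  rw [ModuleCat.isZero_iff_subsingleton]
  rfl

theorem isTorTop_self [Nontrivial κ] : IsTorTop κ (ModuleCat.of A A) 0 := by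
  refine ⟨?_, fun i hi => ?_⟩
  · rw [isZero_tor_zero_iff, not_subsingleton_iff_nontrivial]
    exact (TensorProduct.lid A κ).toEquiv.nontrivial
  · obtain ⟨j, rfl⟩ := Nat.exists_eq_succ_of_ne_zero hi.ne'
    let P := projectiveResolution κ
    have := (Module.Flat.iff_preservesFiniteLimits_tensorLeft (ModuleCat.of A A)).mp inferInstance
    rw [isZero_tor_iff P, ← HomologicalComplex.exactAt_iff_isZero_homology,
      HomologicalComplex.exactAt_iff' _ (j + 2) (j + 1) j (by simp) (by simp)]
    exact (P.exact_succ j).map (tensorLeft (ModuleCat.of A A))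

theorem hasProjectiveDimensionLT_quot_ofList {rs : List A} {a : ℕ} {M : Type} [AddCommGroup M]
    [Module A M] (h : HasProjectiveDimensionLT (ModuleCat.of A M) a)
    (hM : RingTheory.Sequence.IsWeaklyRegular M rs) :
    HasProjectiveDimensionLT (ModuleCat.of A (M ⧸ (Ideal.ofList rs • ⊤ : Submodule A M)))
      (a + rs.length) := by
  induction rs generalizing M a with
  | nil =>
    refine hasProjectiveDimensionLT_of_iso
      (LinearEquiv.toModuleIso (Submodule.quotEquivOfEqBot _ ?_).symm) _
    simp
  | cons r rs ih =>
    rw [RingTheory.Sequence.isWeaklyRegular_cons_iff] at hM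
    have hM₁ : IsSMulRegular (ModuleCat.of A M) r := hM.1
    have h' := ih (hM₁.smulShortComplex_shortExact.hasProjectiveDimensionLT_X₃ a h
      (hasProjectiveDimensionLT_of_ge (ModuleCat.of A M) a _ (by lia))) hM.2
    rw [add_assoc, add_comm 1] at h'
    exact hasProjectiveDimensionLT_of_iso
      (LinearEquiv.toModuleIso (Submodule.quotOfListConsSMulTopEquivQuotSMulTopInner M r rs).symm) _

/-- `A ⧸ (x₁, …, xₘ)A` is the quotient of `A` by the ideal `(x₁, …, xₘ)`. -/
noncomputable def quotOfListSMulTopIso (xs : List A) :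
    ModuleCat.of A (A ⧸ (Ideal.ofList xs • ⊤ : Submodule A A)) ≅
      ModuleCat.of A (A ⧸ Ideal.ofList xs) :=
  LinearEquiv.toModuleIso (Submodule.quotEquivOfEq _ _ (by simp))

theorem smul_id_of_mem {J : Ideal A} {r : A} (hr : r ∈ J) :
    r • 𝟙 (ModuleCat.of A (A ⧸ J)) = 0 := by
  ext
  simpa [Algebra.smul_def] using Ideal.Quotient.eq_zero_iff_mem.mpr hr

theorem isZero_tor_of_length_lt {xs : List A}
    (hxs : RingTheory.Sequence.IsWeaklyRegular A xs) (M : ModuleCat.{0} A) {i : ℕ}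
    (hi : xs.length < i) :
    IsZero (((Tor (ModuleCat A) i).obj M).obj (ModuleCat.of A (A ⧸ Ideal.ofList xs))) := by
  obtain ⟨j, rfl⟩ := Nat.exists_eq_succ_of_ne_zero (show i ≠ 0 by lia)
  have h₀ : HasProjectiveDimensionLT (ModuleCat.of A A) 1 := by
    have : Projective (ModuleCat.of A A) := (IsProjective.iff_projective A).mp inferInstance
    infer_instance
  have h₁ := hasProjectiveDimensionLT_quot_ofList h₀ hxs
  have h₂ := hasProjectiveDimensionLT_of_iso (quotOfListSMulTopIso xs) (1 + xs.length)
  have := hasProjectiveDimensionLT_of_ge (ModuleCat.of A (A ⧸ Ideal.ofList xs)) (1 + xs.length)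
    (j + 1) (by lia)
  exact ((tensoringLeft (ModuleCat A)).obj M).isZero_leftDerived_of_hasProjectiveDimensionLT _ j

theorem isTorTop_quotient_ofList {xs : List A} (hxs : RingTheory.Sequence.IsWeaklyRegular A xs)
    (hne : Ideal.ofList xs ≠ ⊤) :
    IsTorTop (ModuleCat.of A (A ⧸ Ideal.ofList xs)) (ModuleCat.of A (A ⧸ Ideal.ofList xs))
      xs.length := by
  have : Nontrivial (ModuleCat.of A (A ⧸ Ideal.ofList xs)) := Ideal.Quotient.nontrivial_iff.mpr hne
  have h := (isTorTop_self (κ := ModuleCat.of A (A ⧸ Ideal.ofList xs))).quot_ofList (rs := xs)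
    (fun r hr => smul_id_of_mem (Ideal.subset_span hr)) hxs
  rw [zero_add] at h
  exact h.of_iso (quotOfListSMulTopIso xs)

theorem not_isZero_tor_length_of_injective {xs : List A}
    (hxs : RingTheory.Sequence.IsWeaklyRegular A xs) (hne : Ideal.ofList xs ≠ ⊤)
    {N : Type} [AddCommGroup N] [Module A N] (φ : (A ⧸ Ideal.ofList xs) →ₗ[A] N)
    (hφ : Function.Injective φ) :
    ¬ IsZero (((Tor (ModuleCat A) xs.length).obj (ModuleCat.of A N)).obj
      (ModuleCat.of A (A ⧸ Ideal.ofList xs))) := by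
  intro h
  have hS : (ModuleCat.shortComplexOfCompEqZero φ φ.range.mkQ
      (LinearMap.range_mkQ_comp φ)).ShortExact :=
    { exact := ModuleCat.shortComplex_exact _ (LinearMap.exact_map_mkQ_range φ)
      mono_f := (ModuleCat.mono_iff_injective _).mpr hφ
      epi_g := (ModuleCat.epi_iff_surjective _).mpr (Submodule.mkQ_surjective _) }
  exact (isTorTop_quotient_ofList hxs hne).1
    (isZero_tor_of_shortExact hS (isZero_tor_of_length_lt hxs _ (Nat.lt_succ_self _)) h)

end

theorem exists_injective_of_forall_not_isSMulRegular {A : Type*} [CommRing A] [IsNoetherianRing A]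
    (m : Ideal A) [hm : m.IsMaximal] {N : Type*} [AddCommGroup N] [Module A N] [Module.Finite A N]
    (h : ∀ r ∈ m, ¬ IsSMulRegular N r) : ∃ φ : (A ⧸ m) →ₗ[A] N, Function.Injective φ := by
  have hsub : (m : Set A) ⊆ ⋃ p ∈ associatedPrimes A N, (p : Set A) := by
    rw [biUnion_associatedPrimes_eq_compl_regular]
    exact h
  obtain ⟨p, hp, hmp⟩ := (Ideal.subset_union_prime_finite (associatedPrimes.finite A N) ⊥ ⊥
    (fun p hp _ _ => hp.isPrime)).mp hsub
  obtain rfl := hm.eq_of_le hp.isPrime.ne_top hmp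
  obtain ⟨-, x, hx⟩ := Submodule.isAssociatedPrime_iff.mp hp
  have hx' : m = (LinearMap.toSpanSingleton A N x).ker := by
    ext r
    rw [hx]
    simp [Submodule.mem_colon_singleton]
  exact ⟨m.liftQ (LinearMap.toSpanSingleton A N x) hx'.le,
    LinearMap.ker_eq_bot.mp (Submodule.ker_liftQ_eq_bot' _ _ hx')⟩

theorem exists_isTorTop_and_idealDepth_add {A : Type} [CommRing A] [IsNoetherianRing A]
    {xs : List A} (hxs : RingTheory.Sequence.IsWeaklyRegular A xs)
    [hmax : (Ideal.ofList xs).IsMaximal] (M : Type) [AddCommGroup M] [Module A M]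
    [Module.Finite A M] (hM : (⊤ : Submodule A M) ≠ Ideal.ofList xs • ⊤) :
    ∃ a : ℕ, IsTorTop (ModuleCat.of A (A ⧸ Ideal.ofList xs)) (ModuleCat.of A M) a ∧
      idealDepth (Ideal.ofList xs) M + a = xs.length := by
  classical
  let Z (i : ℕ) : Prop := ¬ Limits.IsZero (((Tor (ModuleCat A) i).obj (ModuleCat.of A M)).obj
    (ModuleCat.of A (A ⧸ Ideal.ofList xs)))
  have hZ₀ : Z 0 := by
    intro h
    rw [isZero_tor_zero_iff] at h
    have := (TensorProduct.tensorQuotEquivQuotSMul M (Ideal.ofList xs)).symm.toEquiv.subsingleton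
    exact hM (Submodule.Quotient.subsingleton_iff.mp this).symm
  let a := Nat.findGreatest Z xs.length
  have ha : IsTorTop (ModuleCat.of A (A ⧸ Ideal.ofList xs)) (ModuleCat.of A M) a := by
    refine ⟨Nat.findGreatest_spec (P := Z) (Nat.zero_le _) hZ₀, fun i hi => ?_⟩
    rcases le_or_gt i xs.length with h | h
    · exact not_not.mp (Nat.findGreatest_is_greatest hi h)
    · exact isZero_tor_of_length_lt hxs _ h
  have hquot {rs : List A} (hrs : ∀ r ∈ rs, r ∈ Ideal.ofList xs)
      (hreg : RingTheory.Sequence.IsWeaklyRegular M rs) :=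
    ha.quot_ofList (fun r hr => smul_id_of_mem (hrs r hr)) hreg
  have hle {rs : List A} (hrs : ∀ r ∈ rs, r ∈ Ideal.ofList xs)
      (hreg : RingTheory.Sequence.IsWeaklyRegular M rs) : a + rs.length ≤ xs.length := by
    by_contra! hlt
    exact (hquot hrs hreg).1 (isZero_tor_of_length_lt hxs _ hlt)
  have hregular {rs : List A} (hrs : ∀ r ∈ rs, r ∈ Ideal.ofList xs)
      (hreg : RingTheory.Sequence.IsWeaklyRegular M rs) : RingTheory.Sequence.IsRegular M rs :=
    ⟨hreg, fun h => hM (le_antisymm (h.le.trans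
      (Submodule.smul_mono_left (Ideal.span_le.mpr hrs))) le_top)⟩
  obtain ⟨rs, hrs, hreg, hlen⟩ : ∃ rs : List A, (∀ r ∈ rs, r ∈ Ideal.ofList xs) ∧
      RingTheory.Sequence.IsWeaklyRegular M rs ∧ a + rs.length = xs.length := by
    let Q (n : ℕ) : Prop := ∃ rs : List A, (∀ r ∈ rs, r ∈ Ideal.ofList xs) ∧
      RingTheory.Sequence.IsWeaklyRegular M rs ∧ rs.length = n
    have hQ₀ : Q 0 := ⟨[], by simp, by simp, rfl⟩
    obtain ⟨rs, hrs, hreg, hlen⟩ := Nat.findGreatest_spec (P := Q) (Nat.zero_le xs.length) hQ₀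
    refine ⟨rs, hrs, hreg, (hle hrs hreg).antisymm ?_⟩
    obtain ⟨φ, hφ⟩ := exists_injective_of_forall_not_isSMulRegular (Ideal.ofList xs)
      (N := M ⧸ (Ideal.ofList rs • ⊤ : Submodule A M)) (fun r hr hr' => by
        have hrs' : ∀ x ∈ rs ++ [r], x ∈ Ideal.ofList xs := by
          simpa [or_imp, forall_and] using ⟨hrs, hr⟩
        have hreg' : RingTheory.Sequence.IsWeaklyRegular M (rs ++ [r]) := by
          rw [RingTheory.Sequence.isWeaklyRegular_append_iff,
            RingTheory.Sequence.isWeaklyRegular_singleton_iff]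
          exact ⟨hreg, hr'⟩
        have hlt : Nat.findGreatest Q xs.length < rs.length + 1 := by lia
        refine Nat.findGreatest_is_greatest hlt ?_ ⟨rs ++ [r], hrs', hreg', by simp⟩
        have := hle hrs' hreg'
        simp at this
        lia)
    by_contra! hlt
    exact not_isZero_tor_length_of_injective hxs hmax.ne_top φ hφ ((hquot hrs hreg).2 _ hlt)
  refine ⟨a, ha, ?_⟩
  have hdepth : idealDepth (Ideal.ofList xs) M = rs.length := by
    refine IsGreatest.csSup_eq ⟨⟨rs, rfl, hrs, hregular hrs hreg⟩, ?_⟩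
    rintro _ ⟨rs', rfl, hrs', hreg'⟩
    have := hle hrs' hreg'.toIsWeaklyRegular
    exact Nat.cast_le.mpr (by lia)
  rw [hdepth, ← hlen]
  push_cast
  exact add_comm _ _

theorem irrelevantIdeal_eq_ker (k : Type) [Field k] (σ : Type) :
    irrelevantIdeal k σ = RingHom.ker (constantCoeff (σ := σ) (R := k)) := by
  ext p
  rw [irrelevantIdeal, ← Set.image_univ, mem_ideal_span_X_image, RingHom.mem_ker,
    constantCoeff_eq]
  constructor
  · intro h
    by_contra h₀
    obtain ⟨i, -, hi⟩ := h 0 (mem_support_iff.mpr h₀)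
    exact hi rfl
  · intro h m hm
    by_contra! h'
    obtain rfl : m = 0 := Finsupp.ext fun i => h' i (Set.mem_univ i)
    exact mem_support_iff.mp hm h

instance irrelevantIdeal_isMaximal (k : Type) [Field k] (σ : Type) :
    (irrelevantIdeal k σ).IsMaximal := by
  rw [irrelevantIdeal_eq_ker]
  exact RingHom.ker_isMaximal_of_surjective _ fun c => ⟨C c, constantCoeff_C _ c⟩

theorem irrelevantIdeal_eq_ofList (k : Type) [Field k] (m : ℕ) :
    irrelevantIdeal k (Fin m) = Ideal.ofList (List.ofFn X) := by
  rw [irrelevantIdeal, Ideal.ofList]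
  congr 1
  ext p
  simp [List.mem_ofFn]

theorem MvPolynomial.isWeaklyRegular_ofFn_X (k : Type*) [CommRing k] (m : ℕ) :
    RingTheory.Sequence.IsWeaklyRegular (MvPolynomial (Fin m) k)
      (List.ofFn (X : Fin m → MvPolynomial (Fin m) k)) := by
  refine ⟨fun i hi => ?_⟩
  rw [List.length_ofFn] at hi
  have hI : (Ideal.ofList ((List.ofFn (X : Fin m → MvPolynomial (Fin m) k)).take i) • ⊤ :
      Ideal (MvPolynomial (Fin m) k)) = Ideal.span (X '' {j : Fin m | (j : ℕ) < i}) := by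
    rw [smul_eq_mul, Ideal.mul_top, Ideal.ofList]
    congr 1
    ext p
    simp only [List.mem_take_iff_getElem, Set.mem_ofPred_eq, Set.mem_image]
    constructor
    · rintro ⟨j, hj, rfl⟩
      simp only [List.length_ofFn, lt_inf_iff] at hj
      exact ⟨⟨j, hj.2⟩, hj.1, by simp⟩
    · rintro ⟨j, hj, rfl⟩
      exact ⟨j, by simpa using hj, by simp⟩
  rw [isSMulRegular_quotient_iff_mem_of_smul_mem, hI]
  intro p hp
  rw [mem_ideal_span_X_image] at hp ⊢
  intro e he
  obtain ⟨j, hj, hne⟩ := hp (e + Finsupp.single ⟨i, hi⟩ 1) (by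
    rw [List.getElem_ofFn, smul_eq_mul, mul_comm, mem_support_iff, coeff_mul_X]
    exact mem_support_iff.mp he)
  refine ⟨j, hj, ?_⟩
  rwa [Finsupp.add_apply, Finsupp.single_eq_of_ne (by rintro rfl; exact lt_irrefl i hj),
    add_zero] at hne

theorem torRank_eq_zero_iff (k A M N : Type) [Field k] [CommRing A] [Algebra k A]
    [AddCommGroup M] [Module A M] [AddCommGroup N] [Module A N] (i : ℕ) :
    torRank k A M N i = 0 ↔
      Limits.IsZero (((Tor (ModuleCat A) i).obj (ModuleCat.of A M)).obj (ModuleCat.of A N)) := by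
  rw [ModuleCat.isZero_iff_subsingleton]
  have key (T : ModuleCat.{0} A) : Module.rank k (RestrictScalars k A T) = 0 ↔ Subsingleton T := by
    let : Module k T := Module.compHom T (algebraMap k A)
    exact rank_zero_iff (R := k) (M := T)
  exact key _

/-- The Auslander–Buchsbaum formula for a graded quotient of a polynomial ring. -/
theorem exists_bettiNum_ne_zero_and_idealDepth_add {k : Type} [Field k] {m : ℕ}
    (I : Ideal (MvPolynomial (Fin m) k)) (hI : I ≤ irrelevantIdeal k (Fin m)) :
    ∃ a : ℕ, bettiNum k I a ≠ 0 ∧ (∀ i, a < i → bettiNum k I i = 0) ∧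
      idealDepth (irrelevantIdeal k (Fin m)) (MvPolynomial (Fin m) k ⧸ I) + a = m := by
  simp only [bettiNum, torRank_eq_zero_iff, ne_eq]
  have hmax := irrelevantIdeal_isMaximal k (Fin m)
  rw [irrelevantIdeal_eq_ofList] at hI hmax ⊢
  obtain ⟨a, ha, h⟩ := exists_isTorTop_and_idealDepth_add
    (MvPolynomial.isWeaklyRegular_ofFn_X k m) (MvPolynomial (Fin m) k ⧸ I) (fun h => by
      have hmap := congrArg (Submodule.comap I.mkQ) h
      rw [← Submodule.range_mkQ I, LinearMap.range_eq_map, ← Submodule.map_smul'',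
        Submodule.comap_map_eq, Submodule.comap_map_eq, Submodule.ker_mkQ, top_sup_eq,
        smul_eq_mul, Ideal.mul_top, sup_of_le_left hI] at hmap
      exact hmax.ne_top hmap.symm)
  exact ⟨a, ha.1, ha.2, by simpa using h⟩

theorem IsHomogeneousIdeal.le_irrelevantIdeal {k : Type} [Field k] {σ : Type}
    {I : Ideal (MvPolynomial σ k)} (hI : IsHomogeneousIdeal I) (hne : I ≠ ⊤) :
    I ≤ irrelevantIdeal k σ := by
  intro p hp
  rw [irrelevantIdeal_eq_ker, RingHom.mem_ker]
  by_contra h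
  have h₀ := hI p hp 0
  rw [homogeneousComponent_zero] at h₀
  exact hne (Ideal.eq_top_of_isUnit_mem _ h₀ ((isUnit_iff_ne_zero.mpr h).map C))

theorem not_isCMQuotient_top {k : Type} [Field k] {σ : Type} :
    ¬ IsCMQuotient (⊤ : Ideal (MvPolynomial σ k)) := by
  rw [IsCMQuotient, ringKrullDim_eq_bot_of_subsingleton]
  exact WithBot.coe_ne_bot

theorem RingTheory.Sequence.IsRegular.pos_of_isHomogeneous {k σ : Type*} [Field k] {s : ℕ}
    {f : Fin s → MvPolynomial σ k} {d : Fin s → ℕ} (hdeg : ∀ i, (f i).IsHomogeneous (d i))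
    (hreg : RingTheory.Sequence.IsRegular (MvPolynomial σ k) (List.ofFn f)) (i : Fin s) :
    0 < d i := by
  rw [Nat.pos_iff_ne_zero]
  intro h
  have hne : Ideal.ofList (List.ofFn f) ≠ ⊤ := by simpa using hreg.top_ne_smul.symm
  obtain ⟨c, hc⟩ : ∃ c, f i = C c :=
    ⟨_, totalDegree_eq_zero_iff_eq_C.mp (Nat.le_zero.mp (h ▸ (hdeg i).totalDegree_le))⟩
  rcases eq_or_ne c 0 with rfl | hc₀
  · have := hreg.regular_mod_prev i (by simp)
    rw [isSMulRegular_quotient_iff_mem_of_smul_mem] at this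
    have h₁ := this 1 (by simp [hc])
    rw [smul_eq_mul, Ideal.mul_top] at h₁
    exact hne ((Ideal.eq_top_iff_one _).mpr
      (Ideal.span_mono (fun r => List.mem_of_mem_take (i := i)) h₁))
  · refine hne (Ideal.eq_top_of_isUnit_mem _ (Ideal.subset_span (List.mem_ofFn.mpr ⟨i, rfl⟩)) ?_)
    exact hc ▸ (isUnit_iff_ne_zero.mpr hc₀).map C

instance MvPolynomial.finiteRingKrullDim_of_field (k σ : Type*) [Field k] [Finite σ] :
    FiniteRingKrullDim (MvPolynomial σ k) := by
  rw [finiteRingKrullDim_iff_ne_bot_and_top, ringKrullDim_of_isNoetherianRing,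
    ringKrullDim_eq_zero_of_field, zero_add]
  exact ⟨WithBot.coe_ne_bot, fun h => ENat.natCast_ne_top _ (WithBot.coe_inj.mp h)⟩

/-- The quotient by the irrelevant ideal is the coefficient field. -/
noncomputable def quotientIrrelevantIdealEquiv (k : Type) [Field k] (σ : Type) :
    (MvPolynomial σ k ⧸ irrelevantIdeal k σ) ≃+* k :=
  RingEquiv.ofBijective (Ideal.Quotient.lift (irrelevantIdeal k σ) constantCoeff fun _ hp =>
    RingHom.mem_ker.mp ((irrelevantIdeal_eq_ker k σ).le hp))
    ⟨RingHom.lift_injective_of_ker_le_ideal _ _ (irrelevantIdeal_eq_ker k σ).ge,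
      fun c => ⟨Ideal.Quotient.mk _ (C c), constantCoeff_C σ c⟩⟩

theorem quotientIrrelevantIdealEquiv_smul (k : Type) [Field k] (σ : Type) (p : MvPolynomial σ k)
    (x : MvPolynomial σ k ⧸ irrelevantIdeal k σ) :
    quotientIrrelevantIdealEquiv k σ (p • x) =
      constantCoeff p * quotientIrrelevantIdealEquiv k σ x :=
  map_mul (quotientIrrelevantIdealEquiv k σ) (Ideal.Quotient.mk _ p) x

theorem statement8 (k : Type) [Field k] (s n : ℕ)
    (f : Fin s → MvPolynomial (Fin (n + 1)) k) (d : Fin s → ℕ)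
    (hdeg : ∀ i, (f i).IsHomogeneous (d i))
    (hreg : RingTheory.Sequence.IsRegular (MvPolynomial (Fin (n + 1)) k) (List.ofFn f))
    (I : Ideal (MvPolynomial (Fin s) k)) (homI : IsHomogeneousIdeal I)
    (hcase : (∃ d₀ : ℕ, 0 < d₀ ∧ ∀ i, d i = d₀) ∨
      (∃ T : Set (Fin s →₀ ℕ), I = Ideal.span ((fun e : Fin s →₀ ℕ =>
        (monomial e (1 : k) : MvPolynomial (Fin s) k)) '' T))) :
    (∀ i : ℕ, bettiNum k I i
        = bettiNum k (Ideal.map (MvPolynomial.aeval (R := k) f).toRingHom I) i) ∧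
      (IsCMQuotient I ↔ IsCMQuotient (Ideal.map (MvPolynomial.aeval (R := k) f).toRingHom I)) := by
  let := (aeval (R := k) f).toRingHom.toAlgebra
  have hpos := RingTheory.Sequence.IsRegular.pos_of_isHomogeneous hdeg hreg
  have hfree : Module.Free (MvPolynomial (Fin s) k) (MvPolynomial (Fin (n + 1)) k) :=
    free_of_isRegular_isHomogeneous f d hpos hdeg hreg.toIsWeaklyRegular
  have htower : IsScalarTower k (MvPolynomial (Fin s) k) (MvPolynomial (Fin (n + 1)) k) :=
    .of_algebraMap_eq fun c => ((aeval (R := k) f).commutes c).symm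
  have hcoeff (p : MvPolynomial (Fin s) k) : constantCoeff (aeval f p) = constantCoeff p := by
    have : (constantCoeff.comp (aeval (R := k) f).toRingHom) = constantCoeff := by
      refine MvPolynomial.ringHom_ext (fun c => by simp) fun i => ?_
      simpa [constantCoeff_eq] using (hdeg i).coeff_eq_zero (d := 0) (by simpa using (hpos i).ne)
    exact RingHom.congr_fun this p
  have hbetti (i : ℕ) : bettiNum k I i = bettiNum k (I.map (aeval (R := k) f).toRingHom) i := by
    refine torRank_eq_torRank_map k I ((quotientIrrelevantIdealEquiv k _).trans
      (quotientIrrelevantIdealEquiv k _).symm).toAddEquiv (fun a x => ?_) i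
    apply (quotientIrrelevantIdealEquiv k (Fin (n + 1))).injective
    rw [quotientIrrelevantIdealEquiv_smul]
    refine ((quotientIrrelevantIdealEquiv k _).apply_symm_apply _).trans ?_
    exact (quotientIrrelevantIdealEquiv_smul k _ a x).trans <| congrArg₂ (· * ·) (hcoeff a).symm
      ((quotientIrrelevantIdealEquiv k _).apply_symm_apply _).symm
  refine ⟨hbetti, ?_⟩
  rcases eq_or_ne I ⊤ with rfl | hI
  · rw [Ideal.map_top]
    exact iff_of_false not_isCMQuotient_top not_isCMQuotient_top
  have hIle := homI.le_irrelevantIdeal hI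
  have hJle : I.map (aeval (R := k) f).toRingHom ≤ irrelevantIdeal k (Fin (n + 1)) := by
    rw [Ideal.map_le_iff_le_comap]
    intro p hp
    have := hIle hp
    rw [irrelevantIdeal_eq_ker, RingHom.mem_ker] at this
    rw [Ideal.mem_comap, irrelevantIdeal_eq_ker, RingHom.mem_ker]
    exact (hcoeff p).trans this
  obtain ⟨hsn, hdim⟩ := ringKrullDim_quotient_map_of_faithfullyFlat k
    (fun Q _ => MvPolynomial.height_of_isMaximal (k := k) (m := s) Q)
    (fun Q _ => MvPolynomial.height_of_isMaximal (k := k) (m := n + 1) Q)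
  obtain ⟨a, ha, ha', hdS⟩ := exists_bettiNum_ne_zero_and_idealDepth_add I hIle
  obtain ⟨b, hb, hb', hdR⟩ := exists_bettiNum_ne_zero_and_idealDepth_add _ hJle
  simp_rw [← hbetti] at hb hb'
  obtain rfl : a = b :=
    le_antisymm (not_lt.mp fun h => ha (hb' a h)) (not_lt.mp fun h => hb (ha' b h))
  have hdepth : idealDepth (irrelevantIdeal k (Fin (n + 1)))
      (MvPolynomial (Fin (n + 1)) k ⧸ I.map (aeval (R := k) f).toRingHom) =
      idealDepth (irrelevantIdeal k (Fin s)) (MvPolynomial (Fin s) k ⧸ I) + (n + 1 - s : ℕ) := by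
    rw [← (ENat.addLECancellable_of_ne_top (ENat.natCast_ne_top a)).inj_left, hdR, add_right_comm,
      hdS]
    norm_cast
    lia
  have hdimJ : ringKrullDim
      (MvPolynomial (Fin (n + 1)) k ⧸ I.map (aeval (R := k) f).toRingHom) = _ := hdim I hI
  rw [IsCMQuotient, IsCMQuotient, hdepth, hdimJ, WithBot.coe_add]
  exact ENat.WithBot.add_natCast_cancel.symm
end

section
/- Let Δ be a matroid on [s] of dimension s−1−c, let n ≥ c, and let f_1,…,f_s ∈ R = k[x_0,…,x_n] be homogeneous polynomials such that every subset of at most c+1 of them is an R-regular sequence. Then the ideal φ_*(I_Δ) ⊆ R has height c and R/φ_*(I_Δ) is Cohen–Macaulay. -/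
/- ------------------------------------------------------------------
   Common definitions
------------------------------------------------------------------ -/

open MvPolynomial CategoryTheory

section RegularModuloIdeal

variable {A : Type*} [CommRing A]

/-- Multiplication by `a` is injective on `A ⧸ I`. -/
def IsRegularMod (I : Ideal A) (a : A) : Prop :=
  ∀ x, a * x ∈ I → x ∈ I

/-- The list is a weakly regular sequence on `A ⧸ I`, phrased through ideals of `A` only. -/
def IsWeaklyRegularMod : Ideal A → List A → Prop
  | _, [] => True
  | I, a :: l => IsRegularMod I a ∧ IsWeaklyRegularMod (I ⊔ Ideal.span {a}) l

theorem isSMulRegular_quotient_iff_isRegularMod (I : Ideal A) (a : A) :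
    IsSMulRegular (A ⧸ I) a ↔ IsRegularMod I a :=
  isSMulRegular_quotient_iff_mem_of_smul_mem I a

open scoped Pointwise in
theorem smul_top_quotient_eq_map (I : Ideal A) (a : A) :
    (a • ⊤ : Submodule A (A ⧸ I)) = Submodule.map I.mkQ (Ideal.span {a}) := by
  ext y
  simp only [Submodule.mem_smul_pointwise_iff_exists, Submodule.mem_map,
    Ideal.mem_span_singleton', Submodule.mem_top, true_and]
  constructor
  · rintro ⟨z, rfl⟩
    obtain ⟨w, rfl⟩ := I.mkQ_surjective z
    exact ⟨a * w, ⟨w, mul_comm _ _⟩, by rw [← smul_eq_mul, map_smul]⟩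
  · rintro ⟨_, ⟨w, rfl⟩, rfl⟩
    exact ⟨I.mkQ w, by rw [← map_smul, smul_eq_mul, mul_comm]⟩

/-- Reducing `A ⧸ I` modulo `a` gives `A ⧸ (I + (a))`. -/
noncomputable def quotSMulTopQuotientEquiv (I : Ideal A) (a : A) :
    QuotSMulTop a (A ⧸ I) ≃ₗ[A] A ⧸ (I ⊔ Ideal.span {a}) :=
  Submodule.quotEquivOfEq _ _ (smul_top_quotient_eq_map I a) ≪≫ₗ
    Submodule.quotientQuotientEquivQuotientSup I (Ideal.span {a})

theorem isWeaklyRegular_quotient_iff (I : Ideal A) (l : List A) :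
    RingTheory.Sequence.IsWeaklyRegular (A ⧸ I) l ↔ IsWeaklyRegularMod I l := by
  induction l generalizing I with
  | nil => simp [IsWeaklyRegularMod]
  | cons a l ih =>
    rw [RingTheory.Sequence.isWeaklyRegular_cons_iff, isSMulRegular_quotient_iff_isRegularMod,
      (quotSMulTopQuotientEquiv I a).isWeaklyRegular_congr, ih, IsWeaklyRegularMod]

theorem isWeaklyRegular_iff_bot (l : List A) :
    RingTheory.Sequence.IsWeaklyRegular A l ↔ IsWeaklyRegularMod (⊥ : Ideal A) l := by
  rw [← isWeaklyRegular_quotient_iff,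
    (Submodule.quotEquivOfEqBot (⊥ : Ideal A) rfl).isWeaklyRegular_congr]

theorem IsWeaklyRegularMod.append_iff {I : Ideal A} {l₁ l₂ : List A} :
    IsWeaklyRegularMod I (l₁ ++ l₂) ↔
      IsWeaklyRegularMod I l₁ ∧ IsWeaklyRegularMod (I ⊔ Ideal.ofList l₁) l₂ := by
  induction l₁ generalizing I with
  | nil => simp [IsWeaklyRegularMod]
  | cons a l ih => simp [IsWeaklyRegularMod, ih, and_assoc, sup_assoc]

theorem mem_sup_span_singleton_iff {I : Ideal A} {b x : A} :
    x ∈ I ⊔ Ideal.span {b} ↔ ∃ i ∈ I, ∃ y, x = i + b * y := by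
  simp only [Submodule.mem_sup, Ideal.mem_span_singleton']
  constructor
  · rintro ⟨i, hi, _, ⟨y, rfl⟩, rfl⟩
    exact ⟨i, hi, y, by ring⟩
  · rintro ⟨i, hi, y, rfl⟩
    exact ⟨i, hi, _, ⟨y, rfl⟩, by ring⟩

/-- If `0 → A ⧸ K → A ⧸ J → A ⧸ (J + (f)) → 0` is exact and `l` is weakly regular on the outer
terms, it is weakly regular on the middle term. -/
theorem IsWeaklyRegularMod.of_colon {J K : Ideal A} {f : A} {l : List A}
    (hK : ∀ x, f * x ∈ J ↔ x ∈ K) (h₁ : IsWeaklyRegularMod K l)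
    (h₂ : IsWeaklyRegularMod (J ⊔ Ideal.span {f}) l) : IsWeaklyRegularMod J l := by
  induction l generalizing J K with
  | nil => trivial
  | cons a l ih =>
    obtain ⟨ha₁, hl₁⟩ := h₁
    obtain ⟨ha₂, hl₂⟩ := h₂
    refine ⟨fun x hx => ?_, ih (K := K ⊔ Ideal.span {a}) (fun x => ⟨fun hx => ?_, fun hx => ?_⟩)
      hl₁ (by rwa [sup_right_comm])⟩
    · obtain ⟨j, hj, y, rfl⟩ := mem_sup_span_singleton_iff.1 (ha₂ x (Ideal.mem_sup_left hx))
      refine add_mem hj ((hK y).2 (ha₁ y ((hK _).1 ?_)))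
      have := sub_mem hx (J.mul_mem_left a hj)
      convert this using 1
      ring
    · obtain ⟨j, hj, y, hy⟩ := mem_sup_span_singleton_iff.1 hx
      have hay : a * y ∈ J ⊔ Ideal.span {f} :=
        mem_sup_span_singleton_iff.2 ⟨-j, neg_mem hj, x, by rw [hy]; ring⟩
      obtain ⟨i, hi, z, rfl⟩ := mem_sup_span_singleton_iff.1 (ha₂ y hay)
      refine mem_sup_span_singleton_iff.2 ⟨x - a * z, (hK _).1 ?_, z, by ring⟩
      have := add_mem hj (J.mul_mem_left a hi)
      convert this using 1
      linear_combination hy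
    · obtain ⟨i, hi, y, rfl⟩ := mem_sup_span_singleton_iff.1 hx
      exact mem_sup_span_singleton_iff.2 ⟨f * i, (hK i).2 hi, f * y, by ring⟩

/-- A prime containing `I` and a weakly regular sequence on `A ⧸ I` exceeds the height of some
prime containing `I` by at least the length of the sequence. -/
theorem IsWeaklyRegularMod.exists_prime_height_add_length_le {I P : Ideal A} [hP : P.IsPrime]
    {l : List A} (h : IsWeaklyRegularMod I l) (hI : I ≤ P) (hl : ∀ a ∈ l, a ∈ P) :
    ∃ Q : Ideal A, Q.IsPrime ∧ I ≤ Q ∧ Q ≤ P ∧ Q.height + l.length ≤ P.height := by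
  induction l generalizing I with
  | nil => exact ⟨P, hP, hI, le_rfl, by simp⟩
  | cons a l ih =>
    simp only [List.mem_cons, forall_eq_or_imp] at hl
    obtain ⟨Q', hQ', hle, hQP, hht⟩ := ih h.2
      (sup_le hI (by simpa [Ideal.span_singleton_le_iff_mem] using hl.1)) hl.2
    obtain ⟨Q, hQ, hQQ'⟩ := Ideal.exists_minimalPrimes_le (le_sup_left.trans hle)
    have := hQ.1.1
    have haQ' : a ∈ Q' := hle (Ideal.mem_sup_right (Ideal.mem_span_singleton_self a))
    have haQ : a ∉ Q := by
      intro ha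
      obtain ⟨y, hy, hay⟩ := Ideal.exists_mul_mem_of_mem_minimalPrimes hQ ha
      exact hy (h.1 y hay)
    have hlt : Q < Q' := lt_of_le_of_ne hQQ' (fun e => haQ (e ▸ haQ'))
    refine ⟨Q, hQ.1.1, hQ.1.2, hQQ'.trans hQP, ?_⟩
    have := Ideal.height_add_one_le_of_lt_of_isPrime hlt
    calc Q.height + ((a :: l).length : ℕ) = (Q.height + 1) + l.length := by
          push_cast [List.length_cons]; ring
      _ ≤ Q'.height + l.length := by gcongr
      _ ≤ P.height := hht

/-- No element outside `I` is multiplied into `I` by all of `m`. -/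
def SocleFree (m I : Ideal A) : Prop :=
  ∀ u, (∀ x ∈ m, x * u ∈ I) → u ∈ I

theorem IsRegularMod.socleFree {m I : Ideal A} {a : A} (ha : a ∈ m) (h : IsRegularMod I a) :
    SocleFree m I :=
  fun u hu => h u (hu a ha)

theorem exists_isRegularMod_of_socleFree [IsNoetherianRing A] {m : Ideal A} {ι : Type*}
    (t : Finset ι) (I : ι → Ideal A) (h : ∀ i ∈ t, SocleFree m (I i)) :
    ∃ a ∈ m, ∀ i ∈ t, IsRegularMod (I i) a := by
  classical
  by_contra! hcon
  have hfin : (⋃ i ∈ t, associatedPrimes A (A ⧸ I i)).Finite :=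
    t.finite_toSet.biUnion fun i _ => associatedPrimes.finite A (A ⧸ I i)
  have hsub : (m : Set A) ⊆ ⋃ p ∈ ⋃ i ∈ t, associatedPrimes A (A ⧸ I i), (p : Set A) := by
    intro a ha
    obtain ⟨i, hi, hreg⟩ := hcon a ha
    rw [← isSMulRegular_quotient_iff_isRegularMod] at hreg
    have hmem : a ∈ ⋃ p ∈ associatedPrimes A (A ⧸ I i), (p : Set A) := by
      rw [biUnion_associatedPrimes_eq_compl_regular]
      exact hreg
    simp only [Set.mem_iUnion] at hmem ⊢
    obtain ⟨p, hp, hap⟩ := hmem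
    exact ⟨p, ⟨i, hi, hp⟩, hap⟩
  obtain ⟨p, hp, hmp⟩ := (m.subset_union_prime_finite hfin (f := id) 0 0 (by
    intro p hp _ _
    simp only [Set.mem_iUnion] at hp
    obtain ⟨i, _, hp⟩ := hp
    exact hp.1)).1 hsub
  simp only [Set.mem_iUnion] at hp
  obtain ⟨i, hi, hp⟩ := hp
  obtain ⟨hprime, u, hu⟩ := isAssociatedPrime_iff.1 hp
  obtain ⟨u, rfl⟩ := Ideal.Quotient.mk_surjective u
  have key : ∀ x, x ∈ p ↔ x * u ∈ I i := by
    intro x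
    rw [hu, Submodule.mem_colon_singleton, Submodule.mem_bot, ← Ideal.Quotient.eq_zero_iff_mem]
    rfl
  have hui : u ∈ I i := h i hi u fun x hx => (key x).1 (hmp hx)
  exact hprime.ne_top ((Ideal.eq_top_iff_one p).2 ((key 1).2 (by simpa using hui)))

/-- There is a weakly regular sequence on `A ⧸ I` of length `d` consisting of elements of `m`. -/
def DepthGE (m : Ideal A) : Ideal A → ℕ → Prop
  | _, 0 => True
  | I, d + 1 => ∃ a ∈ m, IsRegularMod I a ∧ DepthGE m (I ⊔ Ideal.span {a}) d

theorem IsRegularMod.swap {I : Ideal A} {a c : A} (ha : IsRegularMod I a)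
    (hac : IsRegularMod (I ⊔ Ideal.span {a}) c) : IsRegularMod (I ⊔ Ideal.span {c}) a := by
  intro u hu
  obtain ⟨i, hi, w, hw⟩ := mem_sup_span_singleton_iff.1 hu
  obtain ⟨j, hj, w', rfl⟩ := mem_sup_span_singleton_iff.1 (hac w
    (mem_sup_span_singleton_iff.2 ⟨-i, neg_mem hi, u, by linear_combination -hw⟩))
  refine mem_sup_span_singleton_iff.2 ⟨u - c * w', ha _ ?_, w', by ring⟩
  have := add_mem hi (I.mul_mem_left c hj)
  convert this using 1
  linear_combination hw

theorem SocleFree.exchange {m I : Ideal A} {a b : A} (hb : b ∈ m) (ha : IsRegularMod I a)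
    (hbr : IsRegularMod I b) (h : SocleFree m (I ⊔ Ideal.span {b})) :
    SocleFree m (I ⊔ Ideal.span {a}) := by
  intro u hu
  obtain ⟨i, hi, w, hw⟩ := mem_sup_span_singleton_iff.1 (hu b hb)
  obtain ⟨j, hj, w', rfl⟩ := mem_sup_span_singleton_iff.1 (h w (fun x hx => by
    obtain ⟨i', hi', y, hy⟩ := mem_sup_span_singleton_iff.1 (hu x hx)
    refine mem_sup_span_singleton_iff.2 ⟨x * w - b * y, ha _ ?_, y, by ring⟩
    have := sub_mem (I.mul_mem_left b hi') (I.mul_mem_left x hi)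
    convert this using 1
    linear_combination b * hy - x * hw))
  refine mem_sup_span_singleton_iff.2 ⟨u - a * w', hbr _ ?_, w', by ring⟩
  have := add_mem hi (I.mul_mem_left a hj)
  convert this using 1
  linear_combination hw

theorem DepthGE.socleFree {m I : Ideal A} {d : ℕ} (h : DepthGE m I (d + 1)) : SocleFree m I := by
  obtain ⟨a, ham, ha, _⟩ := h
  exact ha.socleFree ham

theorem DepthGE.sup_span_singleton [IsNoetherianRing A] {m I : Ideal A} {d : ℕ} {b : A}
    (h : DepthGE m I (d + 1)) (hbm : b ∈ m) (hb : IsRegularMod I b) :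
    DepthGE m (I ⊔ Ideal.span {b}) d := by
  induction d generalizing I b with
  | zero => trivial
  | succ d ih =>
    obtain ⟨a, ham, ha, hd⟩ := h
    obtain ⟨c, hcm, hc⟩ := exists_isRegularMod_of_socleFree (m := m) Finset.univ
      ![I, I ⊔ Ideal.span {a}, I ⊔ Ideal.span {b}] (by
        intro i _
        fin_cases i
        · exact ha.socleFree ham
        · exact hd.socleFree
        · exact SocleFree.exchange ham hb ha hd.socleFree)
    have hcI : IsRegularMod I c := hc 0 (Finset.mem_univ _)
    have hca : IsRegularMod (I ⊔ Ideal.span {a}) c := hc 1 (Finset.mem_univ _)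
    have hcb : IsRegularMod (I ⊔ Ideal.span {b}) c := hc 2 (Finset.mem_univ _)
    have hcd : DepthGE m (I ⊔ Ideal.span {c}) (d + 1) :=
      ⟨a, ham, ha.swap hca, by rw [sup_right_comm]; exact ih hd hcm hca⟩
    exact ⟨c, hcm, hcb, by rw [sup_right_comm]; exact ih hcd hbm (hb.swap hcb)⟩

theorem DepthGE.sup_ofList [IsNoetherianRing A] {m I : Ideal A} {d : ℕ} {l : List A}
    (h : DepthGE m I (d + l.length)) (hlm : ∀ a ∈ l, a ∈ m) (hl : IsWeaklyRegularMod I l) :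
    DepthGE m (I ⊔ Ideal.ofList l) d := by
  induction l generalizing I with
  | nil => simpa using h
  | cons a l ih =>
    simp only [List.mem_cons, forall_eq_or_imp] at hlm
    rw [Ideal.ofList_cons, ← sup_assoc]
    exact ih (DepthGE.sup_span_singleton h hlm.1 hl.1) hlm.2 hl.2

theorem IsWeaklyRegularMod.depthGE {m I : Ideal A} {l : List A} (h : IsWeaklyRegularMod I l)
    (hlm : ∀ a ∈ l, a ∈ m) : DepthGE m I l.length := by
  induction l generalizing I with
  | nil => trivial
  | cons a l ih =>
    simp only [List.mem_cons, forall_eq_or_imp] at hlm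
    exact ⟨a, hlm.1, h.1, ih h.2 hlm.2⟩

theorem exists_common_isWeaklyRegularMod [IsNoetherianRing A] {m : Ideal A} {ι : Type*}
    (t : Finset ι) (I : ι → Ideal A) (d : ℕ) (h : ∀ i ∈ t, DepthGE m (I i) d) :
    ∃ l : List A, l.length = d ∧ (∀ a ∈ l, a ∈ m) ∧ ∀ i ∈ t, IsWeaklyRegularMod (I i) l := by
  induction d generalizing I with
  | zero => exact ⟨[], rfl, by simp, fun _ _ => trivial⟩
  | succ d ih =>
    obtain ⟨a, ham, ha⟩ := exists_isRegularMod_of_socleFree t I fun i hi => (h i hi).socleFree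
    obtain ⟨l, hlen, hlm, hl⟩ := ih (fun i => I i ⊔ Ideal.span {a})
      fun i hi => (h i hi).sup_span_singleton ham (ha i hi)
    exact ⟨a :: l, by simp [hlen], by simpa [ham] using hlm, fun i hi => ⟨ha i hi, hl i hi⟩⟩

end RegularModuloIdeal

section MatroidIdeal

variable {A : Type*} [CommRing A] {s : ℕ}

/-- The ideal generated by the products of the `f i` over the non-faces of `Δ` inside `E`. -/
def nonfaceIdeal (f : Fin s → A) (E : Finset (Fin s)) (Δ : Finset (Fin s) → Prop) : Ideal A :=
  Ideal.span ((fun F : Finset (Fin s) => ∏ i ∈ F, f i) '' {F | F ⊆ E ∧ ¬ Δ F})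

/-- The restriction of the matroid `Δ` to `E` has corank `c`. -/
def HasCorank (E : Finset (Fin s)) (Δ : Finset (Fin s) → Prop) (c : ℕ) : Prop :=
  (∃ B ⊆ E, Δ B ∧ B.card + c = E.card) ∧ ∀ F ⊆ E, Δ F → F.card + c ≤ E.card

theorem prod_mem_nonfaceIdeal {f : Fin s → A} {E F : Finset (Fin s)}
    {Δ : Finset (Fin s) → Prop} (hF : F ⊆ E) (h : ¬ Δ F) :
    ∏ i ∈ F, f i ∈ nonfaceIdeal f E Δ :=
  Ideal.subset_span ⟨F, ⟨hF, h⟩, rfl⟩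

theorem nonfaceIdeal_le_iff {f : Fin s → A} {E : Finset (Fin s)}
    {Δ : Finset (Fin s) → Prop} {I : Ideal A} :
    nonfaceIdeal f E Δ ≤ I ↔ ∀ F ⊆ E, ¬ Δ F → ∏ i ∈ F, f i ∈ I := by
  rw [nonfaceIdeal, Ideal.span_le]
  constructor
  · exact fun h F hF hΔ => h ⟨F, ⟨hF, hΔ⟩, rfl⟩
  · rintro h _ ⟨F, ⟨hF, hΔ⟩, rfl⟩
    exact h F hF hΔ

theorem IsMatroid.exists_superset_card_eq {Δ : Finset (Fin s) → Prop} (hΔ : IsMatroid Δ)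
    {E B F : Finset (Fin s)} (hBE : B ⊆ E) (hB : Δ B) (hFE : F ⊆ E) (hF : Δ F)
    (hcard : F.card ≤ B.card) : ∃ G ⊆ E, F ⊆ G ∧ Δ G ∧ G.card = B.card := by
  obtain ⟨r, hr⟩ := Nat.exists_eq_add_of_le hcard
  induction r generalizing F with
  | zero => exact ⟨F, hFE, subset_rfl, hF, hr.symm⟩
  | succ r ih =>
    obtain ⟨j, hjB, hjF, hj⟩ := hΔ.2.2 B F hB hF (by omega)
    have hc := Finset.card_insert_of_notMem hjF
    obtain ⟨G, hGE, hFG, hG⟩ := ih (Finset.insert_subset (hBE hjB) hFE) hj (by omega) (by omega)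
    exact ⟨G, hGE, (Finset.subset_insert _ _).trans hFG, hG⟩

/-- The faces of the link of `v` in `Δ`. -/
def linkAt (Δ : Finset (Fin s) → Prop) (v : Fin s) (F : Finset (Fin s)) : Prop :=
  v ∉ F ∧ Δ (insert v F)

theorem IsMatroid.isMatroid_linkAt {Δ : Finset (Fin s) → Prop} (hΔ : IsMatroid Δ) {v : Fin s}
    (hv : Δ {v}) : IsMatroid (linkAt Δ v) := by
  refine ⟨⟨by simp, by simpa using hv⟩, fun F G hF hGF => ⟨fun h => hF.1 (hGF h),
    hΔ.2.1 _ _ hF.2 (Finset.insert_subset_insert v hGF)⟩, fun F G hF hG hlt => ?_⟩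
  obtain ⟨j, hjF, hjG, hj⟩ := hΔ.2.2 _ _ hF.2 hG.2 (by
    rw [Finset.card_insert_of_notMem hF.1, Finset.card_insert_of_notMem hG.1]
    omega)
  simp only [Finset.mem_insert, not_or] at hjF hjG
  refine ⟨j, hjF.resolve_left hjG.1, hjG.2, ?_, by rwa [Finset.insert_comm]⟩
  simp only [Finset.mem_insert, not_or]
  exact ⟨Ne.symm hjG.1, hG.1⟩

theorem nonfaceIdeal_insert_of_loop (f : Fin s → A) {E : Finset (Fin s)}
    {Δ : Finset (Fin s) → Prop} {v : Fin s} (hv : ¬ Δ {v}) :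
    nonfaceIdeal f (insert v E) Δ = nonfaceIdeal f E Δ ⊔ Ideal.span {f v} := by
  refine le_antisymm (nonfaceIdeal_le_iff.2 fun F hF hΔF => ?_) (sup_le
    (nonfaceIdeal_le_iff.2 fun F hF hΔF =>
      prod_mem_nonfaceIdeal (hF.trans (Finset.subset_insert _ _)) hΔF)
    ((Ideal.span_singleton_le_iff_mem _).2 ?_))
  · by_cases hvF : v ∈ F
    · exact Ideal.mem_sup_right
        (Ideal.mem_span_singleton.2 (Finset.dvd_prod_of_mem f hvF))
    · exact Ideal.mem_sup_left
        (prod_mem_nonfaceIdeal ((Finset.subset_insert_iff_of_notMem hvF).1 hF) hΔF)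
  · simpa using prod_mem_nonfaceIdeal (f := f) (E := insert v E) (F := {v}) (by simp) hv

theorem nonfaceIdeal_insert_of_coloop (f : Fin s → A) {E : Finset (Fin s)}
    {Δ : Finset (Fin s) → Prop} {v : Fin s} (hv : ∀ F ⊆ E, Δ F → Δ (insert v F)) :
    nonfaceIdeal f (insert v E) Δ = nonfaceIdeal f E Δ := by
  refine le_antisymm (nonfaceIdeal_le_iff.2 fun F hF hΔF => ?_)
    (nonfaceIdeal_le_iff.2 fun F hF hΔF =>
      prod_mem_nonfaceIdeal (hF.trans (Finset.subset_insert _ _)) hΔF)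
  by_cases hvF : v ∈ F
  · rw [← Finset.mul_prod_erase F f hvF]
    refine Ideal.mul_mem_left _ _ (prod_mem_nonfaceIdeal (Finset.subset_insert_iff.1 hF) ?_)
    intro h
    have := hv _ (Finset.subset_insert_iff.1 hF) h
    rw [Finset.insert_erase hvF] at this
    exact hΔF this
  · exact prod_mem_nonfaceIdeal ((Finset.subset_insert_iff_of_notMem hvF).1 hF) hΔF

theorem nonfaceIdeal_le_linkAt (f : Fin s → A) {E : Finset (Fin s)}
    {Δ : Finset (Fin s) → Prop} (hΔ : IsMatroid Δ) (v : Fin s) :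
    nonfaceIdeal f E Δ ≤ nonfaceIdeal f E (linkAt Δ v) :=
  nonfaceIdeal_le_iff.2 fun F hF hΔF => prod_mem_nonfaceIdeal hF
    fun h => hΔF (hΔ.2.1 _ _ h.2 (Finset.subset_insert v F))

/-- The product decomposition of the ideal of a complex into its link and its deletion. -/
theorem nonfaceIdeal_insert (f : Fin s → A) {E : Finset (Fin s)}
    {Δ : Finset (Fin s) → Prop} {v : Fin s} (hvE : v ∉ E) :
    nonfaceIdeal f (insert v E) Δ =
      Ideal.span {f v} * nonfaceIdeal f E (linkAt Δ v) ⊔ nonfaceIdeal f E Δ := by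
  refine le_antisymm (nonfaceIdeal_le_iff.2 fun F hF hΔF => ?_) (sup_le ?_
    (nonfaceIdeal_le_iff.2 fun F hF hΔF =>
      prod_mem_nonfaceIdeal (hF.trans (Finset.subset_insert _ _)) hΔF))
  · by_cases hvF : v ∈ F
    · rw [← Finset.mul_prod_erase F f hvF]
      refine Ideal.mem_sup_left (Ideal.mul_mem_mul (Ideal.mem_span_singleton_self _)
        (prod_mem_nonfaceIdeal (Finset.subset_insert_iff.1 hF) fun h => hΔF ?_))
      simpa [Finset.insert_erase hvF] using h.2
    · exact Ideal.mem_sup_right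
        (prod_mem_nonfaceIdeal ((Finset.subset_insert_iff_of_notMem hvF).1 hF) hΔF)
  · rw [nonfaceIdeal, Ideal.span_mul_span', Ideal.span_le]
    rintro _ ⟨_, rfl, _, ⟨F, ⟨hF, hΔF⟩, rfl⟩, rfl⟩
    have hvF : v ∉ F := fun h => hvE (hF h)
    have := prod_mem_nonfaceIdeal (f := f) (Finset.insert_subset_insert v hF)
      fun h => hΔF ⟨hvF, h⟩
    rwa [Finset.prod_insert hvF] at this

theorem mul_mem_nonfaceIdeal_insert_iff (f : Fin s → A) {E : Finset (Fin s)}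
    {Δ : Finset (Fin s) → Prop} (hΔ : IsMatroid Δ) {v : Fin s} (hvE : v ∉ E)
    (hreg : IsRegularMod (nonfaceIdeal f E Δ) (f v)) (x : A) :
    f v * x ∈ nonfaceIdeal f (insert v E) Δ ↔ x ∈ nonfaceIdeal f E (linkAt Δ v) := by
  rw [nonfaceIdeal_insert f hvE]
  constructor
  · intro hx
    obtain ⟨_, hy, z, hz, hyz⟩ := Submodule.mem_sup.1 hx
    obtain ⟨y, hy', rfl⟩ := Ideal.mem_span_singleton_mul.1 hy
    have : x - y ∈ nonfaceIdeal f E Δ := hreg _ (by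
      convert hz using 1
      linear_combination -hyz)
    simpa using add_mem (nonfaceIdeal_le_linkAt f hΔ v this) hy'
  · exact fun hx => Ideal.mem_sup_left (Ideal.mul_mem_mul (Ideal.mem_span_singleton_self _) hx)

theorem nonfaceIdeal_insert_sup_span (f : Fin s → A) {E : Finset (Fin s)}
    {Δ : Finset (Fin s) → Prop} {v : Fin s} (hvE : v ∉ E) :
    nonfaceIdeal f (insert v E) Δ ⊔ Ideal.span {f v} =
      nonfaceIdeal f E Δ ⊔ Ideal.span {f v} := by
  rw [nonfaceIdeal_insert f hvE, sup_assoc, sup_comm, sup_assoc,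
    sup_eq_left.2 (Ideal.mul_le_left : Ideal.span {f v} * nonfaceIdeal f E (linkAt Δ v) ≤ _)]

/-- A sequence which is weakly regular modulo every `c` of the `f i` is weakly regular modulo the
ideal of a matroid of corank `c`. -/
theorem IsMatroid.isWeaklyRegularMod_nonfaceIdeal (f : Fin s → A) (E : Finset (Fin s)) :
    ∀ (Δ : Finset (Fin s) → Prop) (c : ℕ) (l : List A), IsMatroid Δ → HasCorank E Δ c →
      (∀ T ⊆ E, T.card < c → ∀ v ∈ E, v ∉ T → IsRegularMod (Ideal.span (f '' ↑T)) (f v)) →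
      (∀ T ⊆ E, T.card = c → IsWeaklyRegularMod (Ideal.span (f '' ↑T)) l) →
      IsWeaklyRegularMod (nonfaceIdeal f E Δ) l := by
  induction E using Finset.induction_on with
  | empty =>
    intro Δ c l hΔ hrk _ hl
    have hc : c = 0 := by
      have := hrk.2 ∅ subset_rfl hΔ.1
      simpa using this
    have : nonfaceIdeal f ∅ Δ = ⊥ := by
      rw [eq_bot_iff, nonfaceIdeal_le_iff]
      intro F hF hΔF
      rw [Finset.subset_empty.1 hF] at hΔF
      exact absurd hΔ.1 hΔF
    rw [this]
    simpa using hl ∅ subset_rfl (by simp [hc])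
  | insert v E hvE ih =>
    intro Δ c l hΔ hrk hreg hl
    have hE : E ⊆ insert v E := Finset.subset_insert v E
    have hcE : (insert v E).card = E.card + 1 := Finset.card_insert_of_notMem hvE
    obtain ⟨⟨B, hBE, hB, hBc⟩, hmax⟩ := hrk
    have deletion : ∀ B' ⊆ E, Δ B' → B'.card + c = (insert v E).card →
        IsWeaklyRegularMod (nonfaceIdeal f E Δ) (f v :: l) := by
      intro B' hB'E hB' hB'c
      have hle := Finset.card_le_card hB'E
      obtain ⟨c, rfl⟩ : ∃ c', c = c' + 1 := ⟨c - 1, by omega⟩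
      refine ih Δ c (f v :: l) hΔ ⟨⟨B', hB'E, hB', by omega⟩, fun F hF hΔF => ?_⟩
        (fun T hT hTc w hw hwT => hreg T (hT.trans hE) (by omega) w (hE hw) hwT)
        (fun T hT hTc => ?_)
      · have := hmax F (hF.trans hE) hΔF
        omega
      · have hvT : v ∉ T := fun h => hvE (hT h)
        refine ⟨hreg T (hT.trans hE) (by omega) v (by simp) hvT, ?_⟩
        have := hl (insert v T) (Finset.insert_subset_insert v hT)
          (by rw [Finset.card_insert_of_notMem hvT, hTc])
        rwa [Finset.coe_insert, Set.image_insert_eq, Ideal.span_insert, sup_comm] at this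
    by_cases hloop : Δ {v}
    swap
    · have hvB : v ∉ B := fun h => hloop (hΔ.2.1 _ _ hB (by simpa using h))
      rw [nonfaceIdeal_insert_of_loop f hloop]
      exact (deletion B ((Finset.subset_insert_iff_of_notMem hvB).1 hBE) hB hBc).2
    by_cases hcoloop : ∀ F ⊆ E, Δ F → Δ (insert v F)
    · rw [nonfaceIdeal_insert_of_coloop f hcoloop]
      refine ih Δ c l hΔ ⟨⟨B.erase v, Finset.subset_insert_iff.1 hBE,
        hΔ.2.1 _ _ hB (Finset.erase_subset _ _), ?_⟩, fun F hF hΔF => ?_⟩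
        (fun T hT hTc w hw hwT => hreg T (hT.trans hE) hTc w (hE hw) hwT)
        (fun T hT hTc => hl T (hT.trans hE) hTc)
      · have hvB : v ∈ B := by
          by_contra hvB
          have hBE' := (Finset.subset_insert_iff_of_notMem hvB).1 hBE
          have := hmax _ (Finset.insert_subset_insert v hBE') (hcoloop B hBE' hB)
          rw [Finset.card_insert_of_notMem hvB] at this
          omega
        have := Finset.card_erase_add_one hvB
        omega
      · have := hmax _ (Finset.insert_subset_insert v hF) (hcoloop F hF hΔF)
        rw [Finset.card_insert_of_notMem fun h => hvE (hF h)] at this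
        omega
    · push Not at hcoloop
      obtain ⟨F, hFE, hF, hvF⟩ := hcoloop
      have hle : F.card ≤ B.card := by
        have := hmax F (hFE.trans hE) hF
        omega
      obtain ⟨B', hB'E, hFB', hB', hB'c⟩ :=
        hΔ.exists_superset_card_eq hBE hB (hFE.trans hE) hF hle
      have hvB' : v ∉ B' := fun h => hvF (hΔ.2.1 _ _ hB' (Finset.insert_subset h hFB'))
      have hdel := deletion B' ((Finset.subset_insert_iff_of_notMem hvB').1 hB'E) hB' (by omega)
      refine IsWeaklyRegularMod.of_colon
        (mul_mem_nonfaceIdeal_insert_iff f hΔ hvE hdel.1) ?_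
        (by rw [nonfaceIdeal_insert_sup_span f hvE]; exact hdel.2)
      refine ih (linkAt Δ v) c l (hΔ.isMatroid_linkAt hloop) ⟨?_, fun F hF hΔF => ?_⟩
        (fun T hT hTc w hw hwT => hreg T (hT.trans hE) hTc w (hE hw) hwT)
        (fun T hT hTc => hl T (hT.trans hE) hTc)
      · have hone : ({v} : Finset (Fin s)).card ≤ B.card := by
          have := hmax {v} (by simp) hloop
          omega
        obtain ⟨G, hGE, hvG, hG, hGc⟩ :=
          hΔ.exists_superset_card_eq hBE hB (by simp) hloop hone
        rw [Finset.singleton_subset_iff] at hvG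
        refine ⟨G.erase v, Finset.subset_insert_iff.1 hGE, ⟨by simp, ?_⟩, ?_⟩
        · rwa [Finset.insert_erase hvG]
        · have := Finset.card_erase_add_one hvG
          omega
      · have := hmax _ (Finset.insert_subset_insert v hF) hΔF.2
        rw [Finset.card_insert_of_notMem hΔF.1] at this
        omega

end MatroidIdeal

section Dimension

variable {A : Type*} [CommRing A]

theorem isRegular_map_mk_iff (I : Ideal A) (l : List A) :
    RingTheory.Sequence.IsRegular (A ⧸ I) (l.map (Ideal.Quotient.mk I)) ↔
      RingTheory.Sequence.IsRegular (A ⧸ I) l :=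
  (AddEquiv.refl (A ⧸ I)).isRegular_congr <| List.forall₂_map_left_iff.mpr <|
    List.forall₂_same.mpr fun r _ => algebraMap_smul (A ⧸ I) r

theorem length_le_ringKrullDim_of_isRegular {l : List A}
    (h : RingTheory.Sequence.IsRegular A l) : (l.length : WithBot ℕ∞) ≤ ringKrullDim A := by
  have hne : Ideal.ofList l ≠ ⊤ := fun e => h.top_ne_smul (by simp [e])
  obtain ⟨P, hP, hle⟩ := Ideal.exists_le_maximal _ hne
  have := hP.isPrime
  obtain ⟨Q, -, -, -, hQ⟩ :=
    ((isWeaklyRegular_iff_bot l).1 h.toIsWeaklyRegular).exists_prime_height_add_length_le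
      (P := P) bot_le fun a ha => hle (Ideal.subset_span ha)
  have hlen : (l.length : ℕ∞) ≤ P.height := le_add_self.trans hQ
  calc (l.length : WithBot ℕ∞) = ((l.length : ℕ∞) : WithBot ℕ∞) := rfl
    _ ≤ P.height := WithBot.coe_le_coe.2 hlen
    _ ≤ ringKrullDim A := Ideal.height_le_ringKrullDim_of_isPrime

theorem ringKrullDim_quotient_le_of_le_height {I : Ideal A} {c d : ℕ}
    (hI : ∀ P : PrimeSpectrum A, I ≤ P.asIdeal → (c : ℕ∞) ≤ Order.height P)
    (hA : ringKrullDim A ≤ ((c + d : ℕ) : WithBot ℕ∞)) :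
    ringKrullDim (A ⧸ I) ≤ (d : WithBot ℕ∞) := by
  rw [ringKrullDim_quotient, Order.krullDim]
  refine iSup_le fun p => ?_
  have key : ∀ (i : ℕ) (hi : i < p.length + 1),
      (c : ℕ∞) + i ≤ Order.height (p ⟨i, hi⟩ : PrimeSpectrum A) := by
    intro i
    induction i with
    | zero => exact fun hi => by simpa using hI _ (p ⟨0, hi⟩).2
    | succ i ih =>
      intro hi
      have hlt : (p ⟨i, by omega⟩ : PrimeSpectrum A) < p ⟨i + 1, hi⟩ :=
        p.strictMono (Fin.mk_lt_mk.2 (Nat.lt_succ_self i))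
      calc (c : ℕ∞) + (i + 1 : ℕ) = (c + i) + 1 := by push_cast; ring
        _ ≤ Order.height (p ⟨i, by omega⟩ : PrimeSpectrum A) + 1 := by gcongr; exact ih _
        _ ≤ _ := Order.height_add_one_le hlt
  have h₁ := WithBot.coe_le_coe.2 (key p.length (Nat.lt_succ_self _))
  have h₂ := (h₁.trans (Order.height_le_krullDim _)).trans hA
  have h₃ : c + p.length ≤ c + d := by exact_mod_cast h₂
  have h₄ : p.length ≤ d := by omega
  exact_mod_cast h₄

end Dimension

section PolynomialRing

variable {k : Type} [Field k] {σ : Type}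

theorem mem_irrelevantIdeal_iff {p : MvPolynomial σ k} :
    p ∈ irrelevantIdeal k σ ↔ coeff 0 p = 0 := by
  rw [irrelevantIdeal, ← Set.image_univ, mem_ideal_span_X_image]
  constructor
  · intro h
    by_contra h0
    obtain ⟨i, -, hi⟩ := h 0 (mem_support_iff.2 h0)
    exact hi rfl
  · intro h m hm
    by_contra! hcon
    have : m = 0 := Finsupp.ext fun i => hcon i (Set.mem_univ i)
    exact mem_support_iff.1 hm (this ▸ h)

theorem irrelevantIdeal_ne_top : irrelevantIdeal k σ ≠ ⊤ := by
  rw [Ne, Ideal.eq_top_iff_one, mem_irrelevantIdeal_iff]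
  simp

theorem irrelevantIdeal_isPrime : (irrelevantIdeal k σ).IsPrime := by
  have : irrelevantIdeal k σ = RingHom.ker (constantCoeff (R := k) (σ := σ)) := by
    ext p
    rw [mem_irrelevantIdeal_iff, RingHom.mem_ker, constantCoeff_eq]
  rw [this]
  exact RingHom.ker_isPrime _

theorem MvPolynomial.IsHomogeneous.mem_irrelevantIdeal {p : MvPolynomial σ k} {d : ℕ}
    (hp : p.IsHomogeneous d) (hu : ¬ IsUnit p) : p ∈ irrelevantIdeal k σ := by
  rw [mem_irrelevantIdeal_iff]
  by_contra h
  have hd : d = 0 := by simpa using (hp h).symm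
  subst hd
  have hC := totalDegree_eq_zero_iff_eq_C.1 (Nat.le_zero.1 hp.totalDegree_le)
  exact hu (hC ▸ (isUnit_iff_ne_zero.2 h).map C)

theorem isRegularMod_span_X {S : Set σ} {i : σ} (hi : i ∉ S) :
    IsRegularMod (Ideal.span ((X : σ → MvPolynomial σ k) '' S)) (X i) := by
  intro p hp
  rw [mem_ideal_span_X_image] at hp ⊢
  intro m hm
  obtain ⟨j, hj, hne⟩ := hp (Finsupp.single i 1 + m) (by
    rw [mem_support_iff, coeff_X_mul]
    exact mem_support_iff.1 hm)
  refine ⟨j, hj, ?_⟩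
  have hij : i ≠ j := fun e => hi (e ▸ hj)
  simpa [Finsupp.single_apply, hij] using hne

theorem isWeaklyRegularMod_map_X (S : Set σ) (l : List σ) (hl : l.Nodup) (hS : ∀ i ∈ l, i ∉ S) :
    IsWeaklyRegularMod (Ideal.span ((X : σ → MvPolynomial σ k) '' S)) (l.map X) := by
  induction l generalizing S with
  | nil => trivial
  | cons i l ih =>
    rw [List.nodup_cons] at hl
    simp only [List.mem_cons, forall_eq_or_imp] at hS
    refine ⟨isRegularMod_span_X hS.1, ?_⟩
    have := ih (insert i S) hl.2 (fun j hj => by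
      rw [Set.mem_insert_iff, not_or]
      exact ⟨fun e => hl.1 (e ▸ hj), hS.2 j hj⟩)
    rwa [Set.image_insert_eq, Ideal.span_insert, sup_comm] at this

theorem depthGE_irrelevantIdeal (n : ℕ) :
    DepthGE (irrelevantIdeal k (Fin n)) ⊥ n := by
  have h := isWeaklyRegularMod_map_X (k := k) ∅ (List.finRange n) (List.nodup_finRange n)
    (by simp)
  have hd := h.depthGE (m := irrelevantIdeal k (Fin n)) (by
    simp only [List.mem_map]
    rintro _ ⟨i, -, rfl⟩
    exact Ideal.subset_span ⟨i, rfl⟩)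
  simpa using hd

end PolynomialRing

section SubsetsRegular

variable {A : Type*} [CommRing A] {s c : ℕ} {f : Fin s → A}

theorem span_image_eq_ofList_toList (f : Fin s → A) (T : Finset (Fin s)) :
    Ideal.span (f '' ↑T) = Ideal.ofList (T.toList.map f) := by
  rw [Ideal.ofList]
  congr 1
  ext x
  simp

theorem SubsetsRegular.isWeaklyRegularMod (h : SubsetsRegular f c) {l : List (Fin s)}
    (hl : l.Nodup) (hlc : l.length ≤ c) : IsWeaklyRegularMod ⊥ (l.map f) :=
  (isWeaklyRegular_iff_bot _).1 (h l hl hlc).toIsWeaklyRegular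

theorem SubsetsRegular.isRegularMod (h : SubsetsRegular f c) {T : Finset (Fin s)}
    (hT : T.card < c) {v : Fin s} (hv : v ∉ T) : IsRegularMod (Ideal.span (f '' ↑T)) (f v) := by
  have := h.isWeaklyRegularMod (l := T.toList ++ [v])
    (List.nodup_append.2 ⟨T.nodup_toList, List.nodup_singleton v, by
      rintro a ha b hb rfl
      exact hv (by simpa [List.mem_singleton.1 hb] using ha)⟩) (by simpa using hT)
  rw [List.map_append, IsWeaklyRegularMod.append_iff, bot_sup_eq,
    ← span_image_eq_ofList_toList] at this
  exact this.2.1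

theorem SubsetsRegular.not_isUnit (h : SubsetsRegular f c) (hc : 0 < c) (i : Fin s) :
    ¬ IsUnit (f i) := by
  intro hu
  refine (h [i] (List.nodup_singleton i) hc).top_ne_smul ?_
  simp [Ideal.span_singleton_eq_top.2 hu]

theorem SubsetsRegular.depthGE [IsNoetherianRing A] (h : SubsetsRegular f c) {m : Ideal A}
    (hfm : ∀ i, f i ∈ m) {d : ℕ} {T : Finset (Fin s)} (hT : T.card ≤ c)
    (hm : DepthGE m ⊥ (d + T.card)) : DepthGE m (Ideal.span (f '' ↑T)) d := by
  have := DepthGE.sup_ofList (l := T.toList.map f) (by simpa using hm) (by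
    simp only [List.mem_map]
    rintro _ ⟨i, -, rfl⟩
    exact hfm i) (h.isWeaklyRegularMod T.nodup_toList (by simpa using hT))
  rwa [bot_sup_eq, ← span_image_eq_ofList_toList] at this

theorem SubsetsRegular.le_height (h : SubsetsRegular f c) {P : Ideal A} [P.IsPrime]
    {T : Finset (Fin s)} (hT : T.card ≤ c) (hTP : ∀ i ∈ T, f i ∈ P) :
    (T.card : ℕ∞) ≤ P.height := by
  obtain ⟨Q, -, -, -, hQ⟩ := (h.isWeaklyRegularMod T.nodup_toList
    (by simpa using hT)).exists_prime_height_add_length_le (P := P) bot_le (by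
      simp only [List.mem_map, Finset.mem_toList]
      rintro _ ⟨i, hi, rfl⟩
      exact hTP i hi)
  simpa using le_add_self.trans hQ

end SubsetsRegular

section FullGroundSet

variable {s c : ℕ} {Δ : Finset (Fin s) → Prop}

theorem exists_isBasisOf_superset {F : Finset (Fin s)} (hF : Δ F) :
    ∃ B, F ⊆ B ∧ IsBasisOf Δ B := by
  obtain ⟨B, hFB, hB⟩ := (Set.toFinite {G | Δ G}).exists_le_maximal hF
  exact ⟨B, hFB, hB.1, fun G hG hBG => hB.eq_of_ge hG hBG⟩

theorem hasCorank_univ (hΔ : Δ ∅) (hcs : c ≤ s) (hdim : ∀ F, IsBasisOf Δ F → F.card = s - c) :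
    HasCorank Finset.univ Δ c := by
  refine ⟨?_, fun F _ hF => ?_⟩
  · obtain ⟨B, -, hB⟩ := exists_isBasisOf_superset hΔ
    exact ⟨B, Finset.subset_univ B, hB.1, by rw [hdim B hB, Finset.card_fin]; omega⟩
  · obtain ⟨B, hFB, hB⟩ := exists_isBasisOf_superset hF
    have := Finset.card_le_card hFB
    rw [hdim B hB] at this
    rw [Finset.card_fin]
    omega

/-- A prime containing the ideal of a complex of corank `c` contains `c` of the `f i`. -/
theorem HasCorank.exists_subset_of_nonfaceIdeal_le {A : Type*} [CommRing A] {f : Fin s → A}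
    (h : HasCorank Finset.univ Δ c) {P : Ideal A} [hP : P.IsPrime]
    (hle : nonfaceIdeal f Finset.univ Δ ≤ P) :
    ∃ T : Finset (Fin s), T.card = c ∧ ∀ i ∈ T, f i ∈ P := by
  classical
  let U : Finset (Fin s) := Finset.univ.filter fun i => f i ∈ P
  have hU : Δ Uᶜ := by
    by_contra hU
    obtain ⟨i, hi, hiP⟩ := (hP.prod_mem_iff).1
      (nonfaceIdeal_le_iff.1 hle Uᶜ (Finset.subset_univ _) hU)
    simp [U, hiP] at hi
  have hcard := h.2 _ (Finset.subset_univ _) hU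
  have := Finset.card_compl_add_card U
  rw [Finset.card_univ] at hcard
  obtain ⟨T, hTU, hT⟩ := Finset.exists_subset_card_eq (show c ≤ U.card by omega)
  exact ⟨T, hT, fun i hi => (Finset.mem_filter.1 (hTU hi)).2⟩

theorem map_stanleyReisnerIdeal {k : Type} [Field k] {A : Type*} [CommRing A] [Algebra k A]
    (f : Fin s → A) :
    Ideal.map (MvPolynomial.aeval (R := k) f).toRingHom (stanleyReisnerIdeal k Δ) =
      nonfaceIdeal f Finset.univ Δ := by
  rw [stanleyReisnerIdeal, nonfaceIdeal, Ideal.map_span, Set.image_image]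
  simp

end FullGroundSet

theorem statement9 (k : Type) [Field k] [Infinite k] (s c n : ℕ) (hcs : c ≤ s) (hcn : c ≤ n)
    (Δ : Finset (Fin s) → Prop) (hmat : IsMatroid Δ)
    (hdim : ∀ F, IsBasisOf Δ F → F.card = s - c)
    (f : Fin s → MvPolynomial (Fin (n + 1)) k) (d : Fin s → ℕ)
    (hdeg : ∀ i, (f i).IsHomogeneous (d i))
    (hreg : SubsetsRegular f (c + 1)) :
    idealHeight (Ideal.map (MvPolynomial.aeval (R := k) f).toRingHom
        (stanleyReisnerIdeal k Δ)) = (c : ℕ∞) ∧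
      IsCMQuotient (Ideal.map (MvPolynomial.aeval (R := k) f).toRingHom
        (stanleyReisnerIdeal k Δ)) := by
  rw [map_stanleyReisnerIdeal]
  set J := nonfaceIdeal f Finset.univ Δ
  set m := irrelevantIdeal k (Fin (n + 1))
  have hmp : m.IsPrime := irrelevantIdeal_isPrime
  obtain ⟨e, he⟩ : ∃ e, n + 1 = c + e := ⟨n + 1 - c, by omega⟩
  have hfm : ∀ i, f i ∈ m := fun i =>
    (hdeg i).mem_irrelevantIdeal (hreg.not_isUnit c.succ_pos i)
  have hrk := hasCorank_univ hmat.1 hcs hdim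
  have hJm : J ≤ m := nonfaceIdeal_le_iff.2 fun F _ hF => by
    obtain ⟨i, hi⟩ : F.Nonempty := by
      rw [Finset.nonempty_iff_ne_empty]
      rintro rfl
      exact hF hmat.1
    exact Ideal.mem_of_dvd _ (Finset.dvd_prod_of_mem f hi) (hfm i)
  have hdimR : ringKrullDim (MvPolynomial (Fin (n + 1)) k) = ((c + e : ℕ) : WithBot ℕ∞) := by
    rw [MvPolynomial.ringKrullDim_of_isNoetherianRing, ringKrullDim_eq_zero_of_field, zero_add,
      Nat.card_fin, he]
  have hheight : ∀ P : PrimeSpectrum (MvPolynomial (Fin (n + 1)) k), J ≤ P.asIdeal →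
      (c : ℕ∞) ≤ Order.height P := by
    intro P hP
    obtain ⟨T, rfl, hTP⟩ := hrk.exists_subset_of_nonfaceIdeal_le hP
    rw [← PrimeSpectrum.height_eq_orderHeight]
    exact hreg.le_height (Nat.le_succ _) hTP
  obtain ⟨l, hlen, hlm, hl⟩ := exists_common_isWeaklyRegularMod (m := m)
    (Finset.univ.filter fun T : Finset (Fin s) => T.card = c)
    (fun T => Ideal.span (f '' ↑T)) e (by
      intro T hT
      have hTc : T.card = c := (Finset.mem_filter.1 hT).2
      refine hreg.depthGE hfm (by omega) ?_
      rw [show e + T.card = n + 1 by omega]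
      exact depthGE_irrelevantIdeal (n + 1))
  have hlJ : IsWeaklyRegularMod J l :=
    hmat.isWeaklyRegularMod_nonfaceIdeal f Finset.univ Δ c l hrk
      (fun T _ hTc v _ hv => hreg.isRegularMod (by omega) hv)
      (fun T _ hTc => hl T (by simpa using hTc))
  have hlreg : RingTheory.Sequence.IsRegular (MvPolynomial (Fin (n + 1)) k ⧸ J) l := by
    refine ⟨(isWeaklyRegular_quotient_iff J l).2 hlJ, fun htop => irrelevantIdeal_ne_top
      (k := k) (σ := Fin (n + 1)) ((Ideal.eq_top_iff_one _).2 ?_)⟩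
    have hlem : Ideal.ofList l ≤ m := Ideal.span_le.2 hlm
    have hone : (Ideal.Quotient.mk J 1) ∈ m.map (Ideal.Quotient.mk J) := by
      have h : (Ideal.Quotient.mk J 1) ∈
          Ideal.ofList l • (⊤ : Submodule (MvPolynomial (Fin (n + 1)) k) (_ ⧸ J)) :=
        htop ▸ Submodule.mem_top
      rw [Ideal.smul_top_eq_map] at h
      exact Ideal.map_mono hlem h
    exact (Ideal.mem_quotient_iff_mem hJm).1 hone
  have hle : ringKrullDim (MvPolynomial (Fin (n + 1)) k ⧸ J) ≤ (e : WithBot ℕ∞) :=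
    ringKrullDim_quotient_le_of_le_height hheight hdimR.le
  constructor
  · refine le_antisymm ?_ (le_iInf₂ hheight)
    obtain ⟨Q, hQ, hJQ, -, hQm⟩ := hlJ.exists_prime_height_add_length_le (P := m) hJm hlm
    refine (iInf₂_le (⟨Q, hQ⟩ : PrimeSpectrum _) hJQ).trans ?_
    rw [← PrimeSpectrum.height_eq_orderHeight]
    have h₁ : (m.height : WithBot ℕ∞) ≤ ((c + e : ℕ) : WithBot ℕ∞) :=
      hdimR ▸ Ideal.height_le_ringKrullDim_of_isPrime
    have h₂ : m.height ≤ ((c + e : ℕ) : ℕ∞) := WithBot.coe_le_coe.1 h₁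
    have h₃ := hQm.trans h₂
    rw [hlen, Nat.cast_add] at h₃
    exact (ENat.add_le_add_iff_right (ENat.natCast_ne_top e)).1 h₃
  · have hupper : ∀ rs : List (MvPolynomial (Fin (n + 1)) k),
        RingTheory.Sequence.IsRegular (MvPolynomial (Fin (n + 1)) k ⧸ J) rs →
        (rs.length : WithBot ℕ∞) ≤ ringKrullDim (MvPolynomial (Fin (n + 1)) k ⧸ J) := by
      intro rs hrs
      simpa using length_le_ringKrullDim_of_isRegular ((isRegular_map_mk_iff J rs).2 hrs)
    have hdimJ : ringKrullDim (MvPolynomial (Fin (n + 1)) k ⧸ J) = (e : WithBot ℕ∞) :=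
      le_antisymm hle (hlen ▸ hupper l hlreg)
    rw [IsCMQuotient, hdimJ]
    have hdepth : idealDepth m (MvPolynomial (Fin (n + 1)) k ⧸ J) = (e : ℕ∞) := by
      refine le_antisymm (sSup_le ?_) (le_sSup ⟨l, by rw [hlen], hlm, hlreg⟩)
      rintro _ ⟨rs, rfl, -, hrs⟩
      have := hupper rs hrs
      rw [hdimJ] at this
      exact_mod_cast this
    rw [hdepth]
    rfl
end
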